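/- arXiv:math/9903134 — 2 statements merged into one kernel-verified Lean document; each statement's English description precedes it below -/
import Mathlib

section
/- For any M ≥ N ≥ 1 and any t ≥ 0, ℙ[H(M,N) ≤ t] = (1/Z′_{M,N}) ∫_{[0,t]^N} ∏_{1≤i<j≤N} (x_i − x_j)² · ∏_{j=1}^N x_j^{M−N} e^{−x_j} d^N x, where Z′_{M,N} is the same integral taken over [0,∞)^N. -/
open MeasureTheory Filter

/-- An up/right path from `(1,1)` to `(M,N)`: a sequence of `M+N-1` lattice sites starting at
`(1,1)`, ending at `(M,N)`, each step increasing one coordinate by one. -/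
def UpRightPath (M N : ℕ) (π : ℕ → ℕ × ℕ) : Prop :=
  π 0 = (1, 1) ∧ π (M + N - 2) = (M, N) ∧
    ∀ k, k < M + N - 2 →
      π (k + 1) = ((π k).1 + 1, (π k).2) ∨ π (k + 1) = ((π k).1, (π k).2 + 1)

/-- `H(M,N)`: the maximum over up/right paths from `(1,1)` to `(M,N)` of the sum of the
real site weights `u` along the path. -/
noncomputable def lppSupR (u : ℕ × ℕ → ℝ) (M N : ℕ) : ℝ :=
  sSup {s | ∃ π : ℕ → ℕ × ℕ, UpRightPath M N π ∧
    s = ∑ k ∈ Finset.range (M + N - 1), u (π k)}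

theorem hasDerivAt_det {n : ℕ} {A : ℝ → Matrix (Fin n) (Fin n) ℝ} {A' : Matrix (Fin n) (Fin n) ℝ}
    {s : Set ℝ} {x : ℝ} (h : ∀ i j, HasDerivWithinAt (fun y => A y i j) (A' i j) s x) :
    HasDerivWithinAt (fun y => (A y).det) (∑ i, ((A x).updateRow i (A' i)).det) s x := by
  have h1 : HasDerivWithinAt (fun y => (A y).det)
      (∑ σ : Equiv.Perm (Fin n), (Equiv.Perm.sign σ : ℝ) *
        ∑ i, (∏ j ∈ Finset.univ.erase i, A x j (σ j)) • A' i (σ i)) s x := by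
    have : (fun y => (A y).det) = fun y => ∑ σ : Equiv.Perm (Fin n), (Equiv.Perm.sign σ : ℝ) *
        ∏ i, A y i (σ i) := by
      funext y
      rw [← Matrix.det_transpose, Matrix.det_apply']
      rfl
    rw [this]
    refine HasDerivWithinAt.fun_sum fun σ _ => HasDerivWithinAt.const_mul _ ?_
    exact HasDerivWithinAt.fun_finsetProd fun i _ => h i (σ i)
  convert h1 using 1
  simp_rw [Finset.mul_sum]
  rw [Finset.sum_comm]
  refine Finset.sum_congr rfl fun i _ => ?_
  rw [← Matrix.det_transpose, Matrix.det_apply']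
  refine Finset.sum_congr rfl fun σ _ => ?_
  rw [← Finset.mul_prod_erase _ _ (Finset.mem_univ i)]
  simp only [Matrix.transpose_apply, Matrix.updateRow_self, smul_eq_mul]
  rw [mul_comm (A' i (σ i))]
  congr 2
  refine Finset.prod_congr rfl fun j hj => ?_
  rw [Matrix.updateRow_ne (Finset.ne_of_mem_erase hj)]

/-- Convolution with the exponential density. -/
noncomputable def expConv (f : ℝ → ℝ) (s : ℝ) : ℝ :=
  Real.exp (-s) * ∫ r in (0 : ℝ)..s, Real.exp r * f r

theorem hasDerivAt_expConv {f : ℝ → ℝ} (hf : Continuous f) (s : ℝ) :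
    HasDerivAt (expConv f) (f s - expConv f s) s := by
  have h1 : HasDerivAt (fun s : ℝ => ∫ r in (0 : ℝ)..s, Real.exp r * f r) (Real.exp s * f s) s :=
    (Real.continuous_exp.mul hf).integral_hasStrictDerivAt 0 s |>.hasDerivAt
  have h2 := ((hasDerivAt_neg s).exp).mul h1
  refine h2.congr_deriv ?_
  unfold expConv
  have : Real.exp (-s) * Real.exp s = 1 := by rw [← Real.exp_add]; simp
  linear_combination (f s) * this

/-- The `k`-th derivative of the `m`-fold convolution of the exponential density
with `s ↦ s ^ l / l!`. -/
noncomputable def iterConv : ℕ → ℕ → ℕ → ℝ → ℝ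
  | 0, k, l => fun s => (l.descFactorial k : ℝ) / l.factorial * s ^ (l - k)
  | m + 1, 0, l => expConv (iterConv m 0 l)
  | m + 1, k + 1, l => fun s => iterConv m k l s - iterConv (m + 1) k l s
termination_by m k => (m, k)

theorem iterConv_succ_zero (m l : ℕ) : iterConv (m + 1) 0 l = expConv (iterConv m 0 l) := by
  rw [iterConv]

theorem iterConv_succ_succ (m k l : ℕ) :
    iterConv (m + 1) (k + 1) l = fun s => iterConv m k l s - iterConv (m + 1) k l s := by
  rw [iterConv]

theorem iterConv_add (m k l : ℕ) (s : ℝ) :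
    iterConv (m + 1) k l s + iterConv (m + 1) (k + 1) l s = iterConv m k l s := by
  rw [iterConv_succ_succ]; ring

theorem hasDerivAt_iterConv (m k l : ℕ) (s : ℝ) :
    HasDerivAt (iterConv m k l) (iterConv m (k + 1) l s) s := by
  induction m generalizing k s with
  | zero =>
    rw [iterConv, iterConv]
    have := (hasDerivAt_pow (l - k) s).const_mul ((l.descFactorial k : ℝ) / l.factorial)
    refine this.congr_deriv ?_
    rw [Nat.descFactorial_succ, Nat.sub_sub]
    push_cast
    ring
  | succ m ih =>
    induction k generalizing s with
    | zero =>
      rw [iterConv_succ_succ, iterConv_succ_zero]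
      exact hasDerivAt_expConv (continuous_iff_continuousAt.2 fun s => (ih 0 s).continuousAt) s
    | succ k ihk =>
      have := (ih k s).sub (ihk s)
      rw [iterConv_succ_succ m (k + 1) l, iterConv_succ_succ m k l] at *
      exact this

theorem continuous_iterConv (m k l : ℕ) : Continuous (iterConv m k l) :=
  continuous_iff_continuousAt.2 fun s => (hasDerivAt_iterConv m k l s).continuousAt

theorem iterConv_succ_zero_apply_zero (m l : ℕ) : iterConv (m + 1) 0 l 0 = 0 := by
  rw [iterConv_succ_zero]; simp [expConv]

theorem sum_choose_iterConv (m k r l : ℕ) (s : ℝ) :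
    ∑ q ∈ Finset.range (k + 1), (k.choose q : ℝ) * iterConv (m + k) (r + q) l s =
      iterConv m r l s := by
  induction k generalizing r with
  | zero => simp
  | succ k ih =>
    have h1 : ∀ q, iterConv (m + (k + 1)) (r + q) l s + iterConv (m + (k + 1)) (r + q + 1) l s =
        iterConv (m + k) (r + q) l s := fun q => iterConv_add _ _ _ _
    rw [← ih r]
    simp_rw [← h1, mul_add, Finset.sum_add_distrib]
    rw [Finset.sum_range_succ']
    simp_rw [Nat.choose_succ_succ, Nat.cast_add, add_mul, Finset.sum_add_distrib]
    rw [Finset.sum_range_succ' (fun q => (k.choose q : ℝ) * iterConv (m + (k + 1)) (r + q) l s),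
      Finset.sum_range_succ (fun q => (k.choose (q + 1) : ℝ) * _)]
    simp [add_assoc]
    ring

theorem cauchy_repeated_integral (n : ℕ) {F : ℝ → ℝ} (hF : Continuous F) (s : ℝ) :
    ((fun (f : ℝ → ℝ) (x : ℝ) => ∫ r in (0 : ℝ)..x, f r)^[n + 1] F) s =
      ∫ r in (0 : ℝ)..s, (s - r) ^ n / n.factorial * F r := by
  induction n generalizing F with
  | zero => simp
  | succ n ih =>
    have hd : ∀ x, HasDerivAt (fun x => ∫ r in (0 : ℝ)..x, F r) (F x) x := fun x =>
      (hF.integral_hasStrictDerivAt 0 x).hasDerivAt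
    rw [Function.iterate_succ_apply,
      ih (continuous_iff_continuousAt.2 fun x => (hd x).continuousAt)]
    have hu : ∀ x : ℝ, HasDerivAt (fun r : ℝ => (s - r) ^ (n + 1) / (n + 1).factorial)
        (-((s - x) ^ n / n.factorial)) x := by
      intro x
      have := (((hasDerivAt_id x).const_sub s).pow (n + 1)).div_const ((n + 1).factorial : ℝ)
      refine this.congr_deriv ?_
      rw [Nat.factorial_succ]
      have : (n.factorial : ℝ) ≠ 0 := by positivity
      push_cast
      simp
      field_simp
    have := intervalIntegral.integral_mul_deriv_eq_deriv_mul (a := 0) (b := s)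
      (fun x _ => hu x) (fun x _ => hd x)
      (by apply Continuous.intervalIntegrable; fun_prop) (hF.intervalIntegrable _ _)
    rw [this]
    simp

theorem iterConv_eq_integral (n l : ℕ) (s : ℝ) :
    iterConv (n + 1) 0 l s =
      ∫ r in (0 : ℝ)..s, (r ^ n / n.factorial * Real.exp (-r)) * ((s - r) ^ l / l.factorial) := by
  have h1 : ∀ m, iterConv m 0 l = fun s => Real.exp (-s) *
      ((fun (f : ℝ → ℝ) (x : ℝ) => ∫ r in (0 : ℝ)..x, f r)^[m]
        (fun r => Real.exp r * (r ^ l / l.factorial))) s := by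
    intro m
    induction m with
    | zero =>
      funext s
      rw [iterConv]
      have : Real.exp (-s) * Real.exp s = 1 := by rw [← Real.exp_add]; simp
      simp only [Nat.descFactorial_zero, Nat.cast_one, Nat.sub_zero, Function.iterate_zero, id]
      linear_combination (-(s ^ l / l.factorial)) * this
    | succ m ih =>
      funext s
      rw [iterConv_succ_zero, Function.iterate_succ_apply', expConv]
      congr 1
      refine intervalIntegral.integral_congr fun r _ => ?_
      simp only [ih]
      rw [← mul_assoc, ← Real.exp_add]
      simp
  rw [h1]
  simp only
  rw [cauchy_repeated_integral n (by fun_prop)]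
  rw [← intervalIntegral.integral_const_mul]
  have := intervalIntegral.integral_comp_sub_left (a := 0) (b := s) (fun r => Real.exp (-s) *
    ((s - r) ^ n / n.factorial * (Real.exp r * (r ^ l / l.factorial)))) s
  rw [sub_self, sub_zero] at this
  rw [← this]
  refine intervalIntegral.integral_congr fun r _ => ?_
  have : Real.exp (-r) = Real.exp (-s) * Real.exp (s - r) := by rw [← Real.exp_add]; ring_nf
  rw [this]
  ring

/-- The conditional probability that the last passage time to the end of the last row is at
most `t`, given the last passage times `z` along the current front, in which `k` sites of the
current row and none of the `r` rows after it have been visited. -/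
noncomputable def lppDet (t : ℝ) (N r k : ℕ) (z : ℕ → ℝ) : ℝ :=
  (Matrix.of fun i j : Fin N =>
    if (i : ℕ) < k then iterConv r i.rev j.rev (t - z (i + 1))
    else iterConv (r + 1) i.rev j.rev (t - max (z k) (z (i + 1)))).det

theorem continuous_lppDet (t : ℝ) (N r k : ℕ) : Continuous (lppDet t N r k) := by
  refine Continuous.matrix_det (continuous_matrix fun i j => ?_)
  simp only [Matrix.of_apply]
  split_ifs
  · exact (continuous_iterConv _ _ _).comp (by fun_prop)
  · exact (continuous_iterConv _ _ _).comp (by fun_prop)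

theorem integral_exp_mul_lppDet (t : ℝ) (N r k : ℕ) (hk : k < N) (z : ℕ → ℝ)
    (hz : ∀ i, k + 1 ≤ i → i < N → z i ≤ z (i + 1)) (hkt : z k ≤ t) (hNt : z N ≤ t) :
    ∫ u in (0 : ℝ)..(t - max (z k) (z (k + 1))), Real.exp (-u) *
      lppDet t N r (k + 1) (Function.update z (k + 1) (max (z k) (z (k + 1)) + u)) =
      lppDet t N r k z := by
  have hmono : ∀ i j, k + 1 ≤ i → i ≤ j → j ≤ N → z i ≤ z j := by
    intro i j hi hij
    induction j, hij using Nat.le_induction with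
    | base => intro _; exact le_rfl
    | succ j hj ih => intro h; exact (ih (by omega)).trans (hz j (by omega) (by omega))
  set a := max (z k) (z (k + 1)) with ha
  have hat : a ≤ t := max_le hkt ((hmono (k + 1) N le_rfl hk le_rfl).trans hNt)
  let A : ℝ → Matrix (Fin N) (Fin N) ℝ := fun y => Matrix.of fun i j =>
    if (i : ℕ) < k then iterConv r i.rev j.rev (t - z (i + 1))
    else iterConv (r + 1) i.rev j.rev (t - max y (z (i + 1)))
  let A' : ℝ → Matrix (Fin N) (Fin N) ℝ := fun y => Matrix.of fun i j =>
    if (i : ℕ) < k then 0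
    else if z (i + 1) ≤ y then -iterConv (r + 1) (i.rev + 1) j.rev (t - y) else 0
  have hA' : ∀ y i j, HasDerivWithinAt (fun y => A y i j) (A' y i j) (Set.Ioi y) y := by
    intro y i j
    simp only [A, A', Matrix.of_apply]
    split_ifs with h1 h2
    · exact hasDerivWithinAt_const _ _ _
    · have h3 : HasDerivAt (fun y => iterConv (r + 1) i.rev j.rev (t - y))
          (-iterConv (r + 1) (i.rev + 1) j.rev (t - y)) y := by
        simpa using (hasDerivAt_iterConv (r + 1) i.rev j.rev (t - y)).comp_const_sub t y
      refine h3.hasDerivWithinAt.congr (fun x hx => ?_) ?_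
      · rw [max_eq_left (h2.trans (le_of_lt hx))]
      · rw [max_eq_left h2]
    · refine HasDerivAt.hasDerivWithinAt ?_
      refine (hasDerivAt_const y (iterConv (r + 1) i.rev j.rev
        (t - z (i + 1)))).congr_of_eventuallyEq ?_
      filter_upwards [eventually_lt_nhds (not_le.1 h2)] with x hx
      rw [max_eq_right hx.le]
  have hdet : ∀ y, a ≤ y → lppDet t N r (k + 1) (Function.update z (k + 1) y) =
      (A y).det - ∑ i, ((A y).updateRow i (A' y i)).det := by
    intro y hy
    have hky : z (k + 1) ≤ y := (le_max_right _ _).trans hy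
    rw [Finset.sum_eq_single (⟨k, hk⟩ : Fin N)]
    · have h1 : lppDet t N r (k + 1) (Function.update z (k + 1) y) =
          ((A y).updateRow ⟨k, hk⟩ (A y ⟨k, hk⟩ + (-1 : ℝ) • A' y ⟨k, hk⟩)).det := by
        unfold lppDet
        congr 1
        ext i j
        rcases lt_trichotomy (i : ℕ) k with h | h | h
        · rw [Matrix.updateRow_ne (by intro h'; simp [h'] at h)]
          simp [A, h, h.le, h.ne]
        · obtain rfl : i = ⟨k, hk⟩ := Fin.ext h
          rw [Matrix.updateRow_self]
          simp [A, A', hky]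
          rw [← iterConv_add]
        · rw [Matrix.updateRow_ne (by intro h'; simp [h'] at h)]
          simp [A, h.ne', not_lt.2 h.le, not_le.2 h]
      rw [h1, Matrix.det_updateRow_add, Matrix.det_updateRow_smul, Matrix.updateRow_eq_self]
      ring
    · intro i _ hi
      have hik : (i : ℕ) ≠ k := fun h => hi (Fin.ext h)
      by_cases h1 : (i : ℕ) < k
      · refine Matrix.det_eq_zero_of_row_eq_zero i fun j => ?_
        simp [A', h1]
      by_cases h2 : z (i + 1) ≤ y
      · have hi1 : (i : ℕ) - 1 < N := by omega
        have hi2 : (i : ℕ) - 1 + 1 = i := by omega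
        have h3 : A' y i = (-1 : ℝ) • A y ⟨(i : ℕ) - 1, hi1⟩ := by
          funext j
          have h4 : z i ≤ y := (hz i (by omega) i.2).trans h2
          have h5 : ¬ ((i : ℕ) - 1 < k) := by omega
          have h6 : (i.rev : ℕ) + 1 = (Fin.rev ⟨(i : ℕ) - 1, hi1⟩ : Fin N) := by
            simp only [Fin.val_rev]; omega
          simp only [A, A', Matrix.of_apply, h1, h2, h5, if_true, if_false, Pi.smul_apply,
            smul_eq_mul, hi2, max_eq_left h4, h6]
          ring
        rw [h3, Matrix.det_updateRow_smul, Matrix.det_updateRow_eq_zero, mul_zero]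
        intro h
        have := congrArg Fin.val h
        simp at this
        omega
      · refine Matrix.det_eq_zero_of_row_eq_zero i fun j => ?_
        simp [A', h2]
    · simp
  have hcont : Continuous fun u => Real.exp (-u) *
      lppDet t N r (k + 1) (Function.update z (k + 1) (a + u)) :=
    (Real.continuous_exp.comp continuous_neg).mul ((continuous_lppDet _ _ _ _).comp
      (continuous_const.update _ (by fun_prop)))
  have hAc : Continuous fun y => (A y).det := by
    refine Continuous.matrix_det (continuous_matrix fun i j => ?_)
    simp only [A, Matrix.of_apply]
    split_ifs
    · exact continuous_const
    · exact (continuous_iterConv _ _ _).comp (by fun_prop)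
  have hFTC := intervalIntegral.integral_eq_sub_of_hasDeriv_right_of_le (a := 0) (b := t - a)
    (f := fun u => -(Real.exp (-u) * (A (a + u)).det))
    (f' := fun u => Real.exp (-u) *
      lppDet t N r (k + 1) (Function.update z (k + 1) (a + u))) (by linarith)
    (Continuous.continuousOn ((Real.continuous_exp.comp continuous_neg).mul
      (hAc.comp (by fun_prop))).neg) ?_ (hcont.intervalIntegrable _ _)
  · rw [hFTC]
    have h0 : (A t).det = 0 := by
      refine Matrix.det_eq_zero_of_row_eq_zero ⟨N - 1, by omega⟩ fun j => ?_
      have h1 : N - 1 + 1 = N := by omega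
      have h2 : ¬ (N - 1 < k) := by omega
      simp [A, h1, h2, max_eq_left hNt, iterConv_succ_zero_apply_zero]
    have h1 : A a = Matrix.of fun i j : Fin N =>
        if (i : ℕ) < k then iterConv r i.rev j.rev (t - z (i + 1))
        else iterConv (r + 1) i.rev j.rev (t - max (z k) (z (i + 1))) := by
      ext i j
      simp only [A, Matrix.of_apply]
      split_ifs with h
      · rfl
      · rw [ha, max_assoc, max_eq_right (hmono (k + 1) (i + 1) le_rfl (by omega) i.2)]
    simp [h0, h1, lppDet]
  · intro u hu
    have h1 := hasDerivAt_det (hA' (a + u))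
    have h2 : HasDerivWithinAt (fun u => (A (a + u)).det)
        (∑ i, ((A (a + u)).updateRow i (A' (a + u) i)).det) (Set.Ioi u) u := by
      have h3 := h1.scomp (h := fun u => a + u) (h' := 1) (s := Set.Ioi u) u
        ((hasDerivAt_id u).const_add a).hasDerivWithinAt (fun x hx => by simpa using hx)
      exact h3.congr_deriv (one_smul _ _)
    have h4 := (((hasDerivAt_neg u).exp).hasDerivWithinAt.mul h2).neg
    refine h4.congr_deriv ?_
    rw [hdet (a + u) (by linarith [hu.1])]
    ring

theorem lppDet_zero_all (t : ℝ) (N : ℕ) (z : ℕ → ℝ) : lppDet t N 0 N z = 1 := by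
  unfold lppDet
  rw [Matrix.det_of_isLowerTriangular]
  · refine Finset.prod_eq_one fun i _ => ?_
    simp [iterConv, Nat.descFactorial_self, Nat.factorial_ne_zero]
  · intro i j hij
    have : (i : ℕ) < j := hij
    have h : Nat.descFactorial (j.rev : ℕ) (i.rev : ℕ) = 0 :=
      Nat.descFactorial_of_lt (by simp only [Fin.val_rev]; omega)
    rw [Matrix.of_apply, if_pos i.2, iterConv, h]
    simp

theorem lppDet_succ_all (t : ℝ) (N r : ℕ) (z z' : ℕ → ℝ) (hz : ∀ i ≤ N, z 0 ≤ z i)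
    (hzz' : ∀ i ≤ N, z i = z' i) :
    lppDet t N (r + 1) N z' = lppDet t N r 0 z := by
  unfold lppDet
  congr 1
  ext i j
  simp [max_eq_right (hz (i + 1) i.2), ← hzz' (i + 1) i.2]

/-- Last passage times are ordered along a front with `k` sites of the current row visited. -/
def FrontOrdered (N k : ℕ) (z : ℕ → ℝ) : Prop :=
  (∀ i ≤ N, z 0 ≤ z i) ∧ (∀ i < k, z i ≤ z (i + 1)) ∧
    ∀ i, k + 1 ≤ i → i < N → z i ≤ z (i + 1)

theorem FrontOrdered.update {N k : ℕ} {z : ℕ → ℝ} (h : FrontOrdered N k z) (hk : k < N)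
    {u : ℝ} (hu : 0 ≤ u) :
    FrontOrdered N (k + 1) (Function.update z (k + 1) (max (z k) (z (k + 1)) + u)) := by
  obtain ⟨h1, h2, h3⟩ := h
  have hk1 : z k ≤ max (z k) (z (k + 1)) + u := by linarith [le_max_left (z k) (z (k + 1))]
  refine ⟨fun i hi => ?_, fun i hi => ?_, fun i hi hiN => ?_⟩
  · rw [Function.update_of_ne (by omega : 0 ≠ k + 1)]
    rcases eq_or_ne i (k + 1) with rfl | h
    · rw [Function.update_self]
      exact (h1 k (by omega)).trans hk1
    · rw [Function.update_of_ne h]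
      exact h1 i hi
  · rcases Nat.lt_succ_iff_lt_or_eq.1 hi with h | rfl
    · rw [Function.update_of_ne (by omega), Function.update_of_ne (by omega)]
      exact h2 i h
    · rw [Function.update_of_ne (by omega), Function.update_self]
      exact hk1
  · rw [Function.update_of_ne (by omega), Function.update_of_ne (by omega)]
    exact h3 i (by omega) hiN

theorem FrontOrdered.update_le_iff {N k : ℕ} {z : ℕ → ℝ} (hk : k < N) {u t : ℝ} (hu : 0 ≤ u) :
    (∀ i ≤ N, Function.update z (k + 1) (max (z k) (z (k + 1)) + u) i ≤ t) ↔
      (∀ i ≤ N, z i ≤ t) ∧ max (z k) (z (k + 1)) + u ≤ t := by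
  constructor
  · intro h
    have h1 := h (k + 1) hk
    rw [Function.update_self] at h1
    refine ⟨fun i hi => ?_, h1⟩
    rcases eq_or_ne i (k + 1) with rfl | hne
    · linarith [le_max_right (z k) (z (k + 1))]
    · simpa [Function.update_of_ne hne] using h i hi
  · rintro ⟨h1, h2⟩ i hi
    rcases eq_or_ne i (k + 1) with rfl | hne
    · simpa using h2
    · simpa [Function.update_of_ne hne] using h1 i hi

theorem lppDet_nonneg (t : ℝ) (N r : ℕ) : ∀ k ≤ N, ∀ z : ℕ → ℝ, FrontOrdered N k z →
    (∀ i ≤ N, z i ≤ t) → 0 ≤ lppDet t N r k z := by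
  have hstep : ∀ r, (∀ z, FrontOrdered N N z → (∀ i ≤ N, z i ≤ t) → 0 ≤ lppDet t N r N z) →
      ∀ k ≤ N, ∀ z : ℕ → ℝ, FrontOrdered N k z → (∀ i ≤ N, z i ≤ t) → 0 ≤ lppDet t N r k z := by
    intro r hr k hk
    induction hk using Nat.decreasingInduction with
    | self => exact hr
    | of_succ k hk ih =>
      intro z hz hzt
      rw [← integral_exp_mul_lppDet t N r k hk z hz.2.2 (hzt k hk.le) (hzt N le_rfl)]
      refine intervalIntegral.integral_nonneg
        (sub_nonneg.2 (max_le (hzt k hk.le) (hzt (k + 1) hk))) fun u hu => ?_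
      exact mul_nonneg (Real.exp_nonneg _) (ih _ (hz.update hk hu.1)
        ((FrontOrdered.update_le_iff hk hu.1).2 ⟨hzt, by linarith [hu.2]⟩))
  induction r with
  | zero => exact hstep 0 fun z _ _ => by rw [lppDet_zero_all]; exact zero_le_one
  | succ r ih =>
    refine hstep _ fun z hz hzt => ?_
    rw [lppDet_succ_all t N r z z hz.1 fun _ _ => rfl]
    refine ih 0 (Nat.zero_le _) z ⟨hz.1, fun i hi => absurd hi (Nat.not_lt_zero _),
      fun i _ hi => hz.2.1 i hi⟩ hzt

/-- `lppDet` restricted to fronts that are bounded by `t`. -/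
noncomputable def lppWeight (t : ℝ) (N r k : ℕ) : (ℕ → ℝ) → ENNReal :=
  Set.indicator {z | ∀ i ≤ N, z i ≤ t} fun z => ENNReal.ofReal (lppDet t N r k z)

theorem measurable_lppWeight (t : ℝ) (N r k : ℕ) : Measurable (lppWeight t N r k) := by
  refine Measurable.indicator (continuous_lppDet t N r k).measurable.ennreal_ofReal ?_
  have : {z : ℕ → ℝ | ∀ i ≤ N, z i ≤ t} = ⋂ i, ⋂ (_ : i ≤ N), {z | z i ≤ t} := by
    ext; simp
  rw [this]
  exact MeasurableSet.iInter fun i => MeasurableSet.iInter fun _ =>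
    measurableSet_le (measurable_pi_apply i) measurable_const

theorem lintegral_lppWeight (t : ℝ) (N r k : ℕ) (hk : k < N) (z : ℕ → ℝ)
    (hz : FrontOrdered N k z) :
    ∫⁻ u, lppWeight t N r (k + 1)
      (Function.update z (k + 1) (max (z k) (z (k + 1)) + u)) ∂(ProbabilityTheory.expMeasure 1) =
      lppWeight t N r k z := by
  have hm : Measurable fun u => lppWeight t N r (k + 1)
      (Function.update z (k + 1) (max (z k) (z (k + 1)) + u)) :=
    (measurable_lppWeight _ _ _ _).comp (Continuous.measurable
      (continuous_const.update _ (by fun_prop)))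
  change ∫⁻ u, _ ∂(volume.withDensity (ProbabilityTheory.exponentialPDF 1)) = _
  rw [lintegral_withDensity_eq_lintegral_mul _
    (f := ProbabilityTheory.exponentialPDF 1)
    (ProbabilityTheory.measurable_exponentialPDFReal 1).ennreal_ofReal hm]
  set a := max (z k) (z (k + 1)) with ha
  by_cases hzt : ∀ i ≤ N, z i ≤ t
  · have hat : a ≤ t := max_le (hzt k hk.le) (hzt (k + 1) hk)
    have hcont : Continuous fun u => Real.exp (-u) *
        lppDet t N r (k + 1) (Function.update z (k + 1) (a + u)) :=
      (Real.continuous_exp.comp continuous_neg).mul ((continuous_lppDet _ _ _ _).comp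
        (continuous_const.update _ (by fun_prop)))
    have h1 : lppWeight t N r k z = ENNReal.ofReal (lppDet t N r k z) :=
      Set.indicator_of_mem (s := {z : ℕ → ℝ | ∀ i ≤ N, z i ≤ t}) hzt _
    rw [h1, ← integral_exp_mul_lppDet t N r k hk z hz.2.2 (hzt k hk.le) (hzt N le_rfl),
      intervalIntegral.integral_of_le (by linarith), ← integral_Icc_eq_integral_Ioc,
      ofReal_integral_eq_lintegral_ofReal (hcont.integrableOn_Icc)]
    · rw [← lintegral_indicator measurableSet_Icc]
      refine lintegral_congr fun u => ?_
      rw [Pi.mul_apply]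
      rcases lt_or_ge u 0 with hu | hu
      · rw [ProbabilityTheory.exponentialPDF_of_neg hu, zero_mul, Set.indicator_of_notMem]
        exact fun h => absurd h.1 (not_le.2 hu)
      rw [ProbabilityTheory.exponentialPDF_of_nonneg hu]
      rw [← ha]
      by_cases hut : a + u ≤ t
      · rw [Set.indicator_of_mem (Set.mem_Icc.2 ⟨hu, by linarith⟩), lppWeight,
          Set.indicator_of_mem, ENNReal.ofReal_mul (Real.exp_nonneg _)]
        · simp
        · exact (FrontOrdered.update_le_iff hk hu).2 ⟨hzt, hut⟩
      · rw [Set.indicator_of_notMem (fun h => hut (by linarith [h.2])), lppWeight,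
          Set.indicator_of_notMem, mul_zero]
        exact fun h => hut ((FrontOrdered.update_le_iff hk hu).1 h).2
    · refine (ae_restrict_iff' measurableSet_Icc).2 (Eventually.of_forall fun u hu => ?_)
      exact mul_nonneg (Real.exp_nonneg _) (lppDet_nonneg t N r (k + 1) hk _ (hz.update hk hu.1)
        ((FrontOrdered.update_le_iff hk hu.1).2 ⟨hzt, by linarith [hu.2]⟩))
  · have h1 : lppWeight t N r k z = 0 :=
      Set.indicator_of_notMem (s := {z : ℕ → ℝ | ∀ i ≤ N, z i ≤ t}) hzt _
    rw [h1, ← lintegral_zero (μ := (volume : Measure ℝ))]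
    refine lintegral_congr fun u => ?_
    rw [Pi.mul_apply]
    rcases lt_or_ge u 0 with hu | hu
    · rw [ProbabilityTheory.exponentialPDF_of_neg hu, zero_mul]
    · rw [lppWeight, Set.indicator_of_notMem, mul_zero]
      exact fun h => hzt ((FrontOrdered.update_le_iff hk hu).1 h).1

/-- Last passage times defined by the dynamic programming recursion. -/
noncomputable def lppRec (w : ℕ × ℕ → ℝ) : ℕ → ℕ → ℝ
  | 0, _ => 0
  | _ + 1, 0 => 0
  | m + 1, n + 1 => max (lppRec w m (n + 1)) (lppRec w (m + 1) n) + w (m + 1, n + 1)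
termination_by m n => (m, n)

theorem lppRec_zero_left (w : ℕ × ℕ → ℝ) (n : ℕ) : lppRec w 0 n = 0 := by rw [lppRec]

theorem lppRec_zero_right (w : ℕ × ℕ → ℝ) (m : ℕ) : lppRec w m 0 = 0 := by
  cases m <;> rw [lppRec]

theorem lppRec_succ_succ (w : ℕ × ℕ → ℝ) (m n : ℕ) : lppRec w (m + 1) (n + 1) =
    max (lppRec w m (n + 1)) (lppRec w (m + 1) n) + w (m + 1, n + 1) := by rw [lppRec]

theorem lppRec_le_succ {w : ℕ × ℕ → ℝ} (hw : ∀ p, 0 ≤ w p) (m n : ℕ) :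
    lppRec w m n ≤ lppRec w m (n + 1) := by
  cases m with
  | zero => simp [lppRec_zero_left]
  | succ m =>
    rw [lppRec_succ_succ]
    linarith [hw (m + 1, n + 1), le_max_right (lppRec w m (n + 1)) (lppRec w (m + 1) n)]

theorem lppRec_nonneg {w : ℕ × ℕ → ℝ} (hw : ∀ p, 0 ≤ w p) (m n : ℕ) : 0 ≤ lppRec w m n := by
  rw [← lppRec_zero_right w m]
  exact monotone_nat_of_le_succ (lppRec_le_succ hw m) (Nat.zero_le n)

theorem UpRightPath.sum_le_lppRec (w : ℕ × ℕ → ℝ) {M N : ℕ} {π : ℕ → ℕ × ℕ}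
    (h : UpRightPath M N π) : ∀ k ≤ M + N - 2, 1 ≤ (π k).1 ∧ 1 ≤ (π k).2 ∧
      ∑ i ∈ Finset.range (k + 1), w (π i) ≤ lppRec w (π k).1 (π k).2 := by
  intro k
  induction k with
  | zero =>
    intro _
    rw [h.1]
    simp [lppRec_succ_succ w 0 0, lppRec_zero_left, lppRec_zero_right, h.1]
  | succ k ih =>
    intro hk
    obtain ⟨h1, h2, h3⟩ := ih (by omega)
    rw [Finset.sum_range_succ]
    obtain ⟨a, ha⟩ := Nat.exists_eq_add_of_le' h1
    obtain ⟨b, hb⟩ := Nat.exists_eq_add_of_le' h2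
    rw [ha, hb] at h3
    rcases h.2.2 k (by omega) with h4 | h4
    · rw [h4, ha, hb]
      refine ⟨by simp, by simp, ?_⟩
      rw [lppRec_succ_succ]
      gcongr
      exact h3.trans (le_max_left _ _)
    · rw [h4, ha, hb]
      refine ⟨by simp, by simp, ?_⟩
      rw [lppRec_succ_succ]
      gcongr
      exact h3.trans (le_max_right _ _)

theorem UpRightPath.exists_extend (w : ℕ × ℕ → ℝ) {m n M N : ℕ} (hm : 1 ≤ m) (hn : 1 ≤ n)
    {π : ℕ → ℕ × ℕ} (h : UpRightPath m n π) (hMN : (M, N) = (m + 1, n) ∨ (M, N) = (m, n + 1)) :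
    ∃ π', UpRightPath M N π' ∧ ∑ k ∈ Finset.range (M + N - 1), w (π' k) =
      ∑ k ∈ Finset.range (m + n - 1), w (π k) + w (M, N) := by
  have hs : M + N = m + n + 1 := by
    rcases hMN with h | h <;> (simp only [Prod.mk.injEq] at h; omega)
  refine ⟨fun k => if k ≤ m + n - 2 then π k else (M, N), ⟨by simpa using h.1, ?_, ?_⟩, ?_⟩
  · simp only
    rw [if_neg (by omega)]
  · intro k hk
    simp only
    rw [if_pos (by omega : k ≤ m + n - 2)]
    by_cases hk' : k < m + n - 2
    · rw [if_pos (by omega)]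
      exact h.2.2 k hk'
    · rw [if_neg (by omega), show k = m + n - 2 by omega, h.2.1]
      exact hMN
  · rw [show M + N - 1 = (m + n - 1) + 1 by omega, Finset.sum_range_succ]
    simp only
    rw [if_neg (by omega : ¬ m + n - 1 ≤ m + n - 2)]
    congr 1
    refine Finset.sum_congr rfl fun k hk => ?_
    rw [if_pos (by have := Finset.mem_range.1 hk; omega)]

theorem exists_upRightPath_sum_eq {w : ℕ × ℕ → ℝ} (hw : ∀ p, 0 ≤ w p) (s : ℕ) :
    ∀ m n, m + n = s → ∃ π, UpRightPath (m + 1) (n + 1) π ∧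
      ∑ k ∈ Finset.range (m + 1 + (n + 1) - 1), w (π k) = lppRec w (m + 1) (n + 1) := by
  induction s with
  | zero =>
    intro m n h
    obtain ⟨rfl, rfl⟩ : m = 0 ∧ n = 0 := by omega
    exact ⟨fun _ => (1, 1), ⟨rfl, rfl, fun k hk => by simp at hk⟩,
      by simp [lppRec_succ_succ, lppRec_zero_left, lppRec_zero_right]⟩
  | succ s ih =>
    have up : ∀ m n, m + 1 + n = s + 1 → lppRec w (m + 2) n ≤ lppRec w (m + 1) (n + 1) →
        ∃ π, UpRightPath (m + 2) (n + 1) π ∧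
          ∑ k ∈ Finset.range (m + 2 + (n + 1) - 1), w (π k) = lppRec w (m + 2) (n + 1) := by
      intro m n hmn hle
      obtain ⟨π, h1, h2⟩ := ih m n (by omega)
      obtain ⟨π', h3, h4⟩ := h1.exists_extend w (by omega) (by omega) (Or.inl rfl)
      exact ⟨π', h3, by rw [h4, h2, lppRec_succ_succ w (m + 1) n, max_eq_left hle]⟩
    have right : ∀ m n, m + (n + 1) = s + 1 → lppRec w m (n + 2) ≤ lppRec w (m + 1) (n + 1) →
        ∃ π, UpRightPath (m + 1) (n + 2) π ∧
          ∑ k ∈ Finset.range (m + 1 + (n + 2) - 1), w (π k) = lppRec w (m + 1) (n + 2) := by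
      intro m n hmn hle
      obtain ⟨π, h1, h2⟩ := ih m n (by omega)
      obtain ⟨π', h3, h4⟩ := h1.exists_extend w (by omega) (by omega) (Or.inr rfl)
      exact ⟨π', h3, by rw [h4, h2, lppRec_succ_succ w m (n + 1), max_eq_right hle]⟩
    intro m n h
    rcases m with _ | m
    · rcases n with _ | n
      · omega
      · exact right 0 n h (by rw [lppRec_zero_left]; exact lppRec_nonneg hw _ _)
    · rcases n with _ | n
      · exact up m 0 h (by rw [lppRec_zero_right]; exact lppRec_nonneg hw _ _)
      · rcases le_total (lppRec w (m + 2) (n + 1)) (lppRec w (m + 1) (n + 2)) with hle | hle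
        · exact up m (n + 1) h hle
        · exact right (m + 1) n h hle

theorem lppSupR_eq_lppRec {w : ℕ × ℕ → ℝ} (hw : ∀ p, 0 ≤ w p) {M N : ℕ} (hM : 1 ≤ M)
    (hN : 1 ≤ N) : lppSupR w M N = lppRec w M N := by
  refine IsGreatest.csSup_eq ⟨?_, ?_⟩
  · obtain ⟨m, rfl⟩ := Nat.exists_eq_add_of_le' hM
    obtain ⟨n, rfl⟩ := Nat.exists_eq_add_of_le' hN
    obtain ⟨π, h1, h2⟩ := exists_upRightPath_sum_eq hw (m + n) m n rfl
    exact ⟨π, h1, h2.symm⟩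
  · rintro s ⟨π, h, rfl⟩
    have := (h.sum_le_lppRec w (M + N - 2) le_rfl).2.2
    rwa [h.2.1, show M + N - 2 + 1 = M + N - 1 by omega] at this

/-- Last passage times along the front consisting of `k` sites of row `m + 1` and the
remaining sites of row `m`. -/
noncomputable def lppFront (w : ℕ × ℕ → ℝ) (m k : ℕ) : ℕ → ℝ :=
  fun i => if i ≤ k then lppRec w (m + 1) i else lppRec w m i

theorem lppFront_succ (w : ℕ × ℕ → ℝ) (m k : ℕ) :
    lppFront w m (k + 1) = Function.update (lppFront w m k) (k + 1)
      (max (lppFront w m k k) (lppFront w m k (k + 1)) + w (m + 1, k + 1)) := by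
  funext i
  rcases eq_or_ne i (k + 1) with rfl | h
  · simp [lppFront, lppRec_succ_succ, max_comm]
  · rw [Function.update_of_ne h]
    simp only [lppFront]
    by_cases hi : i ≤ k
    · rw [if_pos hi, if_pos (by omega)]
    · rw [if_neg hi, if_neg (by omega)]

theorem frontOrdered_lppFront {w : ℕ × ℕ → ℝ} (hw : ∀ p, 0 ≤ w p) (N m k : ℕ) :
    FrontOrdered N k (lppFront w m k) := by
  refine ⟨fun i _ => ?_, fun i hi => ?_, fun i hi _ => ?_⟩
  · have h0 : lppFront w m k 0 = 0 := by simp [lppFront, lppRec_zero_right]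
    rw [h0]
    unfold lppFront
    split_ifs <;> exact lppRec_nonneg hw _ _
  · simp only [lppFront]
    rw [if_pos hi.le, if_pos (by omega : i + 1 ≤ k)]
    exact lppRec_le_succ hw _ _
  · simp only [lppFront]
    rw [if_neg (by omega), if_neg (by omega)]
    exact lppRec_le_succ hw _ _

theorem measurable_lppRec {Ω : Type*} {mΩ : MeasurableSpace Ω} {v : ℕ × ℕ → Ω → ℝ} (m n : ℕ)
    (hv : ∀ i j, i ≤ m → j ≤ n → Measurable (v (i, j))) :
    Measurable fun ω => lppRec (fun p => v p ω) m n := by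
  induction m generalizing n with
  | zero => simp only [lppRec_zero_left]; exact measurable_const
  | succ m ihm =>
    induction n with
    | zero => simp only [lppRec_zero_right]; exact measurable_const
    | succ n ihn =>
      simp only [lppRec_succ_succ]
      exact ((ihm (n + 1) fun i j hi hj => hv i j (by omega) hj).max
        (ihn fun i j hi hj => hv i j hi (by omega))).add (hv _ _ le_rfl le_rfl)

theorem measurable_lppFront {Ω : Type*} {mΩ : MeasurableSpace Ω} {v : ℕ × ℕ → Ω → ℝ} (m k : ℕ)
    (hv : ∀ i j, i ≤ m ∨ i = m + 1 ∧ j ≤ k → Measurable (v (i, j))) :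
    Measurable fun ω => lppFront (fun p => v p ω) m k := by
  refine measurable_pi_lambda _ fun i => ?_
  unfold lppFront
  split_ifs with h
  · exact measurable_lppRec _ _ fun a b ha hb => hv a b (by omega)
  · exact measurable_lppRec _ _ fun a b ha hb => hv a b (by omega)

open ProbabilityTheory in
theorem indepFun_lppFront {Ω : Type*} [MeasurableSpace Ω] {μ : Measure Ω}
    {v : ℕ × ℕ → Ω → ℝ} (hmeas : ∀ p, Measurable (v p)) (hindep : iIndepFun v μ) (m k : ℕ) :
    IndepFun (fun ω => lppFront (fun p => v p ω) m k) (v (m + 1, k + 1)) μ := by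
  let S : Set (ℕ × ℕ) := {p | p.1 ≤ m ∨ p.1 = m + 1 ∧ p.2 ≤ k}
  have hST : Disjoint S {(m + 1, k + 1)} := by
    rw [Set.disjoint_singleton_right]
    simp [S]
  have h := indep_iSup_of_disjoint (fun p => (hmeas p).comap_le) hindep.iIndep hST
  rw [iSup_singleton] at h
  refine (IndepFun_iff_Indep _ _ _).2 (indep_of_indep_of_le_left h ?_)
  refine Measurable.comap_le ?_
  refine measurable_lppFront m k fun i j hij => ?_
  exact (comap_measurable (v (i, j))).mono (le_iSup₂_of_le (i, j) hij le_rfl) le_rfl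

open ProbabilityTheory in
theorem lintegral_lppWeight_lppFront {Ω : Type*} [MeasurableSpace Ω] {μ : Measure Ω}
    [IsProbabilityMeasure μ] {v : ℕ × ℕ → Ω → ℝ} (hmeas : ∀ p, Measurable (v p))
    (hindep : iIndepFun v μ) (hnonneg : ∀ p ω, 0 ≤ v p ω)
    (hlaw : ∀ p, μ.map (v p) = expMeasure 1) (t : ℝ) (N r m k : ℕ) (hk : k < N) :
    ∫⁻ ω, lppWeight t N r (k + 1) (lppFront (fun p => v p ω) m (k + 1)) ∂μ =
      ∫⁻ ω, lppWeight t N r k (lppFront (fun p => v p ω) m k) ∂μ := by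
  have := isProbabilityMeasure_expMeasure one_pos
  have hF : Measurable fun ω => lppFront (fun p => v p ω) m k :=
    measurable_lppFront m k fun i j _ => hmeas (i, j)
  have hind := (indepFun_iff_map_prod_eq_prod_map_map hF.aemeasurable
    (hmeas (m + 1, k + 1)).aemeasurable).1 (indepFun_lppFront hmeas hindep m k)
  let f : (ℕ → ℝ) × ℝ → ENNReal := fun q => lppWeight t N r (k + 1)
    (Function.update q.1 (k + 1) (max (q.1 k) (q.1 (k + 1)) + q.2))
  have hf : Measurable f := (measurable_lppWeight _ _ _ _).comp (Continuous.measurable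
    (continuous_fst.update _ (by fun_prop)))
  calc _ = ∫⁻ ω, f (lppFront (fun p => v p ω) m k, v (m + 1, k + 1) ω) ∂μ := by
        simp only [lppFront_succ, f]
    _ = ∫⁻ q, f q ∂(μ.map fun ω => (lppFront (fun p => v p ω) m k, v (m + 1, k + 1) ω)) :=
        (lintegral_map hf (hF.prodMk (hmeas _))).symm
    _ = ∫⁻ ω, ∫⁻ u, f (lppFront (fun p => v p ω) m k, u) ∂(expMeasure 1) ∂μ := by
        rw [hind, hlaw, lintegral_prod _ hf.aemeasurable,
          lintegral_map hf.lintegral_prod_right' hF]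
    _ = _ := lintegral_congr fun ω => lintegral_lppWeight t N r k hk _
        (frontOrdered_lppFront (fun p => hnonneg p ω) N m k)

open ProbabilityTheory in
theorem measure_lppRec_le {Ω : Type*} [MeasurableSpace Ω] {μ : Measure Ω}
    [IsProbabilityMeasure μ] {v : ℕ × ℕ → Ω → ℝ} (hmeas : ∀ p, Measurable (v p))
    (hindep : iIndepFun v μ) (hnonneg : ∀ p ω, 0 ≤ v p ω)
    (hlaw : ∀ p, μ.map (v p) = expMeasure 1) {t : ℝ} (ht : 0 ≤ t) (M N : ℕ) :
    μ {ω | lppRec (fun p => v p ω) (M + 1) N ≤ t} =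
      ENNReal.ofReal (lppDet t N M 0 fun _ => 0) := by
  have hrow : ∀ r m, ∫⁻ ω, lppWeight t N r N (lppFront (fun p => v p ω) m N) ∂μ =
      ∫⁻ ω, lppWeight t N r 0 (lppFront (fun p => v p ω) m 0) ∂μ := by
    intro r m
    have : ∀ k ≤ N, ∫⁻ ω, lppWeight t N r k (lppFront (fun p => v p ω) m k) ∂μ =
        ∫⁻ ω, lppWeight t N r 0 (lppFront (fun p => v p ω) m 0) ∂μ := by
      intro k
      induction k with
      | zero => intro _; rfl
      | succ k ih =>
        intro hk
        rw [lintegral_lppWeight_lppFront hmeas hindep hnonneg hlaw t N r m k hk, ih (by omega)]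
    exact this N le_rfl
  have hfront : ∀ w : ℕ × ℕ → ℝ, ∀ m, ∀ i ≤ N, lppFront w (m + 1) 0 i = lppFront w m N i := by
    intro w m i hi
    rcases Nat.eq_zero_or_pos i with rfl | h
    · simp [lppFront, lppRec_zero_right]
    · simp [lppFront, hi, h.ne']
  have hmono : ∀ ω r m, lppWeight t N (r + 1) N (lppFront (fun p => v p ω) m N) =
      lppWeight t N r 0 (lppFront (fun p => v p ω) (m + 1) 0) := by
    intro ω r m
    have h := hfront (fun p => v p ω) m
    have hle : (∀ i ≤ N, lppFront (fun p => v p ω) m N i ≤ t) ↔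
        ∀ i ≤ N, lppFront (fun p => v p ω) (m + 1) 0 i ≤ t :=
      forall₂_congr fun i hi => by rw [h i hi]
    simp only [lppWeight, Set.indicator_apply, Set.mem_ofPred_eq, hle]
    rw [lppDet_succ_all t N r (lppFront (fun p => v p ω) (m + 1) 0) _
      (frontOrdered_lppFront (fun p => hnonneg p ω) N (m + 1) 0).1 h]
  have hall : ∀ r m, r + m = M → ∫⁻ ω, lppWeight t N 0 N (lppFront (fun p => v p ω) M N) ∂μ =
      ∫⁻ ω, lppWeight t N r 0 (lppFront (fun p => v p ω) m 0) ∂μ := by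
    intro r
    induction r with
    | zero =>
      intro m hm
      rw [← hm, zero_add, hrow]
    | succ r ih =>
      intro m hm
      rw [ih (m + 1) (by omega), ← hrow (r + 1) m]
      exact lintegral_congr fun ω => (hmono ω r m).symm
  have hset : MeasurableSet {ω | lppRec (fun p => v p ω) (M + 1) N ≤ t} :=
    measurableSet_le (measurable_lppRec _ _ fun i j _ _ => hmeas (i, j)) measurable_const
  have h0 : ∀ w, lppFront w 0 0 = fun _ => 0 := by
    intro w
    funext i
    rcases Nat.eq_zero_or_pos i with rfl | h
    · simp [lppFront, lppRec_zero_right]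
    · simp [lppFront, h.ne', lppRec_zero_left]
  have hfin := hall M 0 rfl
  simp only [h0, lintegral_const, measure_univ, mul_one] at hfin
  rw [lppWeight, lppWeight, Set.indicator_of_mem (by simpa using fun _ _ => ht)] at hfin
  rw [← hfin, ← lintegral_indicator_one hset]
  refine lintegral_congr fun ω => ?_
  have hw : ∀ p, 0 ≤ v p ω := fun p => hnonneg p ω
  have hiff : (∀ i ≤ N, lppFront (fun p => v p ω) M N i ≤ t) ↔
      lppRec (fun p => v p ω) (M + 1) N ≤ t := by
    constructor
    · intro h
      simpa [lppFront] using h N le_rfl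
    · intro h i hi
      simp only [lppFront, if_pos hi]
      exact (monotone_nat_of_le_succ (lppRec_le_succ hw (M + 1)) hi).trans h
  simp [Set.indicator_apply, hiff, lppDet_zero_all]

open ProbabilityTheory in
theorem map_eq_expMeasure {Ω : Type*} [MeasurableSpace Ω] {μ : Measure Ω}
    [IsProbabilityMeasure μ] {X : Ω → ℝ} (hX : Measurable X)
    (hexp : ∀ t, 0 ≤ t → μ {ω | X ω ≤ t} = ENNReal.ofReal (1 - Real.exp (-t))) :
    μ.map X = expMeasure 1 := by
  have := isProbabilityMeasure_expMeasure one_pos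
  have := Measure.isProbabilityMeasure_map (μ := μ) hX.aemeasurable
  refine Measure.eq_of_cdf _ _ (StieltjesFunction.ext fun x => ?_)
  rw [cdf_expMeasure_eq one_pos, cdf_eq_real, map_measureReal_apply hX measurableSet_Iic]
  change (μ {ω | X ω ≤ x}).toReal = _
  split_ifs with h
  · rw [hexp x h, ENNReal.toReal_ofReal, one_mul]
    simpa using h
  · have h0 : μ {ω | X ω ≤ x} = 0 := by
      refine measure_mono_null (t := {ω | X ω ≤ 0}) (fun ω hω => ?_) (by simp [hexp 0 le_rfl])
      exact (show X ω ≤ x from hω).trans (not_le.1 h).le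
    simp [h0]

open ProbabilityTheory in
theorem measure_lppSupR_le {Ω : Type*} [MeasurableSpace Ω] {μ : Measure Ω}
    [IsProbabilityMeasure μ] {u : ℕ × ℕ → Ω → ℝ} (hmeas : ∀ p, Measurable (u p))
    (hindep : iIndepFun u μ)
    (hexp : ∀ p t, 0 ≤ t → μ {ω | u p ω ≤ t} = ENNReal.ofReal (1 - Real.exp (-t)))
    {t : ℝ} (ht : 0 ≤ t) (M N : ℕ) (hN : 1 ≤ N) :
    μ {ω | lppSupR (fun p => u p ω) (M + 1) N ≤ t} =
      ENNReal.ofReal (lppDet t N M 0 fun _ => 0) := by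
  have hae : ∀ᵐ ω ∂μ, ∀ p, 0 ≤ u p ω := by
    refine ae_all_iff.2 fun p => ?_
    refine measure_mono_null (t := {ω | u p ω ≤ 0}) (fun ω hω => ?_) (by simp [hexp p 0 le_rfl])
    exact (not_le.1 (show ¬0 ≤ u p ω from hω)).le
  have hmax : Measurable fun x : ℝ => max x 0 := by fun_prop
  rw [← measure_lppRec_le (v := fun p ω => max (u p ω) 0) (fun p => hmax.comp (hmeas p))
    (hindep.comp (fun _ x => max x 0) fun _ => hmax) (fun p ω => le_max_right _ _) ?_ ht M N]
  · refine measure_congr ?_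
    filter_upwards [hae] with ω hω
    have : (fun p => max (u p ω) 0) = fun p => u p ω := funext fun p => max_eq_left (hω p)
    refine congrArg (· ≤ t) ?_
    simp only [this]
    exact lppSupR_eq_lppRec hω (by omega) hN
  · intro p
    rw [← map_eq_expMeasure (hmeas p) (hexp p)]
    refine Measure.map_congr ?_
    filter_upwards [hae] with ω hω
    exact max_eq_left (hω p)

/-- **Andréief's identity**. -/
theorem integral_det_mul_det {ι : Type*} [Fintype ι] [DecidableEq ι] {E : Type*}
    [MeasurableSpace E] {ν : Measure E} [SigmaFinite ν] (f g : ι → E → ℝ)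
    (h : ∀ i j, Integrable (fun y => f i y * g j y) ν) :
    ∫ x : ι → E, (Matrix.of fun k i => f k (x i)).det * (Matrix.of fun l i => g l (x i)).det
        ∂(Measure.pi fun _ => ν) =
      (Fintype.card ι).factorial * (Matrix.of fun k l => ∫ y, f k y * g l y ∂ν).det := by
  have h1 : ∀ x : ι → E,
      (Matrix.of fun k i => f k (x i)).det * (Matrix.of fun l i => g l (x i)).det =
        ∑ τ : Equiv.Perm ι, ∑ σ : Equiv.Perm ι,
          ((Equiv.Perm.sign τ : ℝ) * (Equiv.Perm.sign σ : ℝ)) *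
            ∏ i, (f (σ i) (x i) * g (τ i) (x i)) := fun x => by
    rw [mul_comm, Matrix.det_apply', Matrix.det_apply', Finset.sum_mul_sum]
    refine Finset.sum_congr rfl fun τ _ => Finset.sum_congr rfl fun σ _ => ?_
    simp only [Matrix.of_apply, Finset.prod_mul_distrib]
    ring
  have hint : ∀ σ τ : Equiv.Perm ι, Integrable
      (fun x : ι → E => ∏ i, (f (σ i) (x i) * g (τ i) (x i))) (Measure.pi fun _ => ν) :=
    fun σ τ => Integrable.fintype_prod (f := fun i y => f (σ i) y * g (τ i) y)
      fun i => h (σ i) (τ i)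
  simp_rw [h1]
  rw [integral_finsetSum _ fun τ _ => integrable_finsetSum _ fun σ _ => (hint σ τ).const_mul _]
  have h2 : ∀ τ : Equiv.Perm ι, ∫ x : ι → E, ∑ σ : Equiv.Perm ι,
      ((Equiv.Perm.sign τ : ℝ) * (Equiv.Perm.sign σ : ℝ)) *
        ∏ i, (f (σ i) (x i) * g (τ i) (x i)) ∂(Measure.pi fun _ => ν) =
      (Matrix.of fun k l => ∫ y, f k y * g l y ∂ν).det := fun τ => by
    rw [integral_finsetSum _ fun σ _ => (hint σ τ).const_mul _]
    have h3 := Matrix.det_permute' τ (Matrix.of fun k l => ∫ y, f k y * g l y ∂ν)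
    have h4 : (Equiv.Perm.sign τ : ℝ) * (Equiv.Perm.sign τ : ℝ) = 1 := by
      rcases Int.units_eq_one_or (Equiv.Perm.sign τ) with h | h <;> simp [h]
    rw [← one_mul (Matrix.det _), ← h4, mul_assoc, ← h3, Matrix.det_apply', Finset.mul_sum]
    refine Finset.sum_congr rfl fun σ _ => ?_
    rw [integral_const_mul,
      integral_fintype_prod_eq_prod (fun i y => f (σ i) y * g (τ i) y), mul_assoc]
    simp
  simp_rw [h2]
  simp [Fintype.card_perm]

theorem lppDet_zero_eq_det_integral (t : ℝ) (N m : ℕ) :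
    lppDet t (N + 1) (m + N) 0 (fun _ => 0) =
      (Matrix.of fun k l : Fin (N + 1) => ∫ y in (0 : ℝ)..t,
        (y ^ (m + k : ℕ) / (m + k : ℕ).factorial * Real.exp (-y)) *
          ((t - y) ^ (l.rev : ℕ) / (l.rev : ℕ).factorial)).det := by
  set P : Matrix (Fin (N + 1)) (Fin (N + 1)) ℝ :=
    Matrix.of fun i r => ((i.rev : ℕ).choose (r.rev : ℕ) : ℝ) with hP
  have hPdet : P.det = 1 := by
    rw [Matrix.det_of_isUpperTriangular]
    · simp [hP]
    · intro i j hij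
      have : (j : ℕ) < i := hij
      simp only [hP, Matrix.of_apply, Nat.cast_eq_zero]
      refine Nat.choose_eq_zero_of_lt ?_
      simp only [Fin.val_rev]
      omega
  rw [← one_mul (lppDet _ _ _ _ _), ← hPdet, lppDet, ← Matrix.det_mul]
  congr 1
  ext i j
  simp only [Matrix.mul_apply, hP, Matrix.of_apply, Nat.not_lt_zero, if_false, max_self, sub_zero]
  rw [← iterConv_eq_integral, ← sum_choose_iterConv (m + i + 1) (i.rev : ℕ) 0]
  have hi : m + i + 1 + (i.rev : ℕ) = m + N + 1 := by
    simp only [Fin.val_rev]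
    omega
  rw [hi, ← Equiv.sum_comp Fin.revPerm]
  simp only [Fin.revPerm_apply, Fin.rev_rev, zero_add]
  rw [Fin.sum_univ_eq_sum_range
    (fun q => ((i.rev : ℕ).choose q : ℝ) * iterConv (m + N + 1) q j.rev t) (N + 1)]
  symm
  refine Finset.sum_subset (Finset.range_subset_range.2 (by omega)) fun q _ hq => ?_
  rw [Nat.choose_eq_zero_of_lt (by simpa using hq)]
  simp

/-- The unnormalized density of the Laguerre unitary ensemble. -/
noncomputable def laguerreWeight (N m : ℕ) (x : Fin N → ℝ) : ℝ :=
  (∏ i : Fin N, ∏ j ∈ Finset.Ioi i, (x i - x j) ^ 2) * ∏ j : Fin N, x j ^ m * Real.exp (-x j)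

theorem continuous_laguerreWeight (N m : ℕ) : Continuous (laguerreWeight N m) := by
  unfold laguerreWeight
  fun_prop

theorem laguerreWeight_nonneg (N m : ℕ) {x : Fin N → ℝ} (hx : ∀ i, 0 ≤ x i) :
    0 ≤ laguerreWeight N m x :=
  mul_nonneg (Finset.prod_nonneg fun _ _ => Finset.prod_nonneg fun _ _ => sq_nonneg _)
    (Finset.prod_nonneg fun j _ => mul_nonneg (pow_nonneg (hx j) _) (Real.exp_pos _).le)

theorem det_mul_det_eq_laguerreWeight (N m : ℕ) (t : ℝ) (x : Fin (N + 1) → ℝ) :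
    (Matrix.of fun k i : Fin (N + 1) =>
        x i ^ (m + k : ℕ) / (m + k : ℕ).factorial * Real.exp (-x i)).det *
      (Matrix.of fun l i : Fin (N + 1) =>
        (t - x i) ^ (l.rev : ℕ) / (l.rev : ℕ).factorial).det =
      ((∏ k : Fin (N + 1), ((m + k : ℕ).factorial : ℝ)⁻¹) *
        ∏ l : Fin (N + 1), ((l.rev : ℕ).factorial : ℝ)⁻¹) * laguerreWeight (N + 1) m x := by
  have h1 : (Matrix.of fun k i : Fin (N + 1) =>
      x i ^ (m + k : ℕ) / (m + k : ℕ).factorial * Real.exp (-x i)).det =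
      (∏ k : Fin (N + 1), ((m + k : ℕ).factorial : ℝ)⁻¹) *
        ((∏ i, x i ^ m * Real.exp (-x i)) *
          ∏ i : Fin (N + 1), ∏ j ∈ Finset.Ioi i, (x j - x i)) := by
    rw [← Matrix.det_vandermonde, ← Matrix.det_transpose (Matrix.vandermonde x),
      ← Matrix.det_mul_row, ← Matrix.det_mul_column]
    congr 1
    ext k i
    simp only [Matrix.of_apply, Matrix.transpose_apply, Matrix.vandermonde_apply]
    ring
  have h2 : (Matrix.of fun l i : Fin (N + 1) =>
      (t - x i) ^ (l.rev : ℕ) / (l.rev : ℕ).factorial).det =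
      (∏ l : Fin (N + 1), ((l.rev : ℕ).factorial : ℝ)⁻¹) *
        ∏ i : Fin (N + 1), ∏ j ∈ Finset.Ioi i, (x j - x i) := by
    have h3 := Matrix.det_projVandermonde (fun _ => (1 : ℝ)) fun i => t - x i
    simp only [one_mul, sub_sub_sub_cancel_left] at h3
    rw [← h3, ← Matrix.det_transpose (Matrix.projVandermonde _ _), ← Matrix.det_mul_column]
    congr 1
    ext l i
    simp only [Matrix.of_apply, Matrix.transpose_apply, Matrix.projVandermonde_apply]
    ring
  rw [h1, h2, laguerreWeight]
  have h4 : (∏ i : Fin (N + 1), ∏ j ∈ Finset.Ioi i, (x i - x j) ^ 2) =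
      (∏ i : Fin (N + 1), ∏ j ∈ Finset.Ioi i, (x j - x i)) *
        ∏ i : Fin (N + 1), ∏ j ∈ Finset.Ioi i, (x j - x i) := by
    simp only [← Finset.prod_mul_distrib]
    refine Finset.prod_congr rfl fun i _ => Finset.prod_congr rfl fun j _ => ?_
    ring
  rw [h4]
  ring

theorem exists_lppDet_eq_mul_integral (N m : ℕ) : ∃ C : ℝ, ∀ t, 0 ≤ t →
    lppDet t (N + 1) (m + N) 0 (fun _ => 0) =
      C * ∫ x in Set.univ.pi fun _ => Set.Icc 0 t, laguerreWeight (N + 1) m x := by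
  refine ⟨((N + 1).factorial : ℝ)⁻¹ * ((∏ k : Fin (N + 1), ((m + k : ℕ).factorial : ℝ)⁻¹) *
        ∏ l : Fin (N + 1), ((l.rev : ℕ).factorial : ℝ)⁻¹), fun t ht => ?_⟩
  have h := integral_det_mul_det (ν := volume.restrict (Set.Icc 0 t))
    (fun (k : Fin (N + 1)) y => y ^ (m + k : ℕ) / (m + k : ℕ).factorial * Real.exp (-y))
    (fun (l : Fin (N + 1)) y => (t - y) ^ (l.rev : ℕ) / (l.rev : ℕ).factorial)
    fun i j => Continuous.integrableOn_Icc (by fun_prop)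
  simp only [det_mul_det_eq_laguerreWeight] at h
  rw [integral_const_mul, ← Measure.restrict_pi_pi, ← volume_pi, Fintype.card_fin] at h
  rw [mul_assoc, h, inv_mul_cancel_left₀ (by positivity), lppDet_zero_eq_det_integral]
  simp only [intervalIntegral.integral_of_le ht, integral_Icc_eq_integral_Ioc]

theorem aecover_pi_Icc (N : ℕ) :
    AECover (volume.restrict (Set.univ.pi fun _ : Fin N => Set.Ici (0 : ℝ))) atTop
      fun n : ℕ => Set.univ.pi fun _ : Fin N => Set.Icc (0 : ℝ) n where
  ae_eventually_mem := by
    filter_upwards [ae_restrict_mem (MeasurableSet.univ_pi fun _ => measurableSet_Ici)] with x hx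
    obtain ⟨n, hn⟩ := exists_nat_ge (∑ i, |x i|)
    filter_upwards [eventually_ge_atTop n] with k hk i _
    refine ⟨hx i trivial, ?_⟩
    calc x i ≤ |x i| := le_abs_self _
      _ ≤ ∑ i, |x i| := Finset.single_le_sum (f := fun i => |x i|)
          (fun i _ => abs_nonneg (x i)) (Finset.mem_univ i)
      _ ≤ n := hn
      _ ≤ k := by exact_mod_cast hk
  measurableSet _ := MeasurableSet.univ_pi fun _ => measurableSet_Icc

theorem integral_laguerreWeight_eq (N m : ℕ) {I : ℝ}
    (h : Tendsto (fun n : ℕ => ∫ x in Set.univ.pi fun _ => Set.Icc (0 : ℝ) n,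
      laguerreWeight N m x) atTop (nhds I)) :
    ∫ x in Set.univ.pi fun _ => Set.Ici (0 : ℝ), laguerreWeight N m x = I := by
  have hr : ∀ n : ℕ,
      (volume.restrict (Set.univ.pi fun _ : Fin N => Set.Ici (0 : ℝ))).restrict
        (Set.univ.pi fun _ => Set.Icc (0 : ℝ) n) =
      volume.restrict (Set.univ.pi fun _ => Set.Icc (0 : ℝ) n) := fun n => by
    refine Measure.restrict_restrict_of_subset (Set.pi_mono fun _ _ => ?_)
    exact Set.Icc_subset_Ici_self
  refine (aecover_pi_Icc N).integral_eq_of_tendsto_of_nonneg_ae I ?_ (fun n => ?_) ?_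
  · filter_upwards [ae_restrict_mem (MeasurableSet.univ_pi fun _ => measurableSet_Ici)] with x hx
    exact laguerreWeight_nonneg N m fun i => hx i trivial
  · rw [IntegrableOn, hr]
    exact (continuous_laguerreWeight N m).continuousOn.integrableOn_compact
      (isCompact_univ_pi fun _ => isCompact_Icc)
  · simpa only [hr] using h

theorem tendsto_measure_le_natCast {Ω : Type*} [MeasurableSpace Ω] {μ : Measure Ω}
    [IsProbabilityMeasure μ] (X : Ω → ℝ) :
    Tendsto (fun n : ℕ => (μ {ω | X ω ≤ n}).toReal) atTop (nhds 1) := by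
  have h := tendsto_measure_iUnion_atTop (μ := μ) (s := fun n : ℕ => {ω | X ω ≤ n})
    fun a b hab ω (hω : X ω ≤ a) => hω.trans (by exact_mod_cast hab)
  have hU : ⋃ n : ℕ, {ω | X ω ≤ n} = Set.univ :=
    Set.eq_univ_of_forall fun ω => Set.mem_iUnion.2 (exists_nat_ge (X ω))
  rw [hU, measure_univ] at h
  exact (ENNReal.tendsto_toReal ENNReal.one_ne_top).comp h

/-- Proposition 1.4: for `M ≥ N ≥ 1` and `t ≥ 0`,
`ℙ[H(M,N) ≤ t] = (Z′)⁻¹ ∫_{[0,t]^N} ∏_{i<j}(x_i−x_j)² ∏_j x_j^{M−N} e^{−x_j} dx`,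
where `Z′` is the same integral over `[0,∞)^N`. -/
theorem stmt5
    {Ω : Type*} [MeasurableSpace Ω] (ℙ : Measure Ω) [IsProbabilityMeasure ℙ]
    (u : ℕ × ℕ → Ω → ℝ)
    (hmeas : ∀ p, Measurable (u p))
    (hindep : ProbabilityTheory.iIndepFun u ℙ)
    (hexp : ∀ p t, 0 ≤ t → ℙ {ω | u p ω ≤ t} = ENNReal.ofReal (1 - Real.exp (-t)))
    (M N : ℕ) (hN : 1 ≤ N) (hMN : N ≤ M) (t : ℝ) (ht : 0 ≤ t) :
    (ℙ {ω | lppSupR (fun p => u p ω) M N ≤ t}).toReal =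
      (∫ x : Fin N → ℝ in Set.univ.pi fun _ => Set.Icc (0 : ℝ) t,
        (∏ i : Fin N, ∏ j ∈ Finset.Ioi i, (x i - x j) ^ 2) *
          ∏ j : Fin N, x j ^ (M - N) * Real.exp (-x j)) /
      (∫ x : Fin N → ℝ in Set.univ.pi fun _ => Set.Ici (0 : ℝ),
        (∏ i : Fin N, ∏ j ∈ Finset.Ioi i, (x i - x j) ^ 2) *
          ∏ j : Fin N, x j ^ (M - N) * Real.exp (-x j)) := by
  obtain ⟨m, rfl⟩ := Nat.exists_eq_add_of_le' hMN
  obtain ⟨N, rfl⟩ := Nat.exists_eq_add_of_le' hN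
  rw [Nat.add_sub_cancel, ← add_assoc]
  change _ = (∫ x in Set.univ.pi fun _ => Set.Icc 0 t, laguerreWeight (N + 1) m x) /
    ∫ x in Set.univ.pi fun _ => Set.Ici 0, laguerreWeight (N + 1) m x
  obtain ⟨C, hC⟩ := exists_lppDet_eq_mul_integral N m
  have hprob : ∀ s, 0 ≤ s → (ℙ {ω | lppSupR (fun p => u p ω) (m + N + 1) (N + 1) ≤ s}).toReal =
      C * ∫ x in Set.univ.pi fun _ => Set.Icc 0 s, laguerreWeight (N + 1) m x := fun s hs => by
    rw [measure_lppSupR_le hmeas hindep hexp hs _ _ hN, ENNReal.toReal_ofReal, hC s hs]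
    exact lppDet_nonneg _ _ _ _ (Nat.zero_le _) _ (by simp [FrontOrdered]) fun _ _ => hs
  have hlim := tendsto_measure_le_natCast (μ := ℙ)
    fun ω => lppSupR (fun p => u p ω) (m + N + 1) (N + 1)
  simp only [hprob _ (Nat.cast_nonneg _)] at hlim
  have hC0 : C ≠ 0 := by
    rintro rfl
    simp only [zero_mul] at hlim
    exact zero_ne_one (tendsto_nhds_unique tendsto_const_nhds hlim)
  have hlim' := hlim.const_mul C⁻¹
  simp only [inv_mul_cancel_left₀ hC0, mul_one] at hlim'
  rw [hprob t ht, integral_laguerreWeight_eq _ _ hlim', div_inv_eq_mul, mul_comm]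
end

section
/- For each γ ≥ 1, lim_{N→∞} (1/N) 𝔼[H(⌊γN⌋, N)] = (1+√γ)². -/
open MeasureTheory Filter

/-- Last-passage percolation on `ℕ²` with bulk weights `u` and with the weights on the horizontal
and vertical axes multiplied by `a` and `b` respectively; the corner `(0,0)` has weight zero. -/
noncomputable def boundaryLPP (a b : ℝ) (u : ℕ × ℕ → ℝ) : ℕ → ℕ → ℝ
  | 0, 0 => 0
  | i + 1, 0 => boundaryLPP a b u i 0 + a * u (i + 1, 0)
  | 0, j + 1 => boundaryLPP a b u 0 j + b * u (0, j + 1)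
  | i + 1, j + 1 =>
      max (boundaryLPP a b u i (j + 1)) (boundaryLPP a b u (i + 1) j) + u (i + 1, j + 1)

section Deterministic

variable {u : ℕ × ℕ → ℝ} {a b a' b' θ : ℝ}

lemma boundaryLPP_nonneg (hu : ∀ p, 0 ≤ u p) (ha : 0 ≤ a) (hb : 0 ≤ b) (i j : ℕ) :
    0 ≤ boundaryLPP a b u i j := by
  fun_induction boundaryLPP a b u i j with
  | case1 => exact le_rfl
  | case2 i ih => exact add_nonneg ih (mul_nonneg ha (hu _))
  | case3 j ih => exact add_nonneg ih (mul_nonneg hb (hu _))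
  | case4 i j ih₁ ih₂ => exact add_nonneg (le_max_of_le_left ih₁) (hu _)

lemma boundaryLPP_mono (hu : ∀ p, 0 ≤ u p) (ha : a ≤ a') (hb : b ≤ b') (i j : ℕ) :
    boundaryLPP a b u i j ≤ boundaryLPP a' b' u i j := by
  fun_induction boundaryLPP a b u i j with
  | case1 => simp [boundaryLPP]
  | case2 i ih => simp only [boundaryLPP]; gcongr; exact hu _
  | case3 j ih => simp only [boundaryLPP]; gcongr; exact hu _
  | case4 i j ih₁ ih₂ => simp only [boundaryLPP]; gcongr

lemma boundaryLPP_zero_left (i : ℕ) : boundaryLPP 0 b u i 0 = 0 := by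
  induction i <;> simp_all [boundaryLPP]

lemma boundaryLPP_zero_right (j : ℕ) : boundaryLPP a 0 u 0 j = 0 := by
  induction j <;> simp_all [boundaryLPP]

/-- An optimal path uses at most one of the two axes. -/
lemma boundaryLPP_eq_max (hu : ∀ p, 0 ≤ u p) (ha : 0 ≤ a) (hb : 0 ≤ b) (i j : ℕ) :
    boundaryLPP a b u i j = max (boundaryLPP a 0 u i j) (boundaryLPP 0 b u i j) := by
  fun_induction boundaryLPP a b u i j with
  | case1 => simp [boundaryLPP]
  | case2 i ih =>
    rw [boundaryLPP_zero_left, max_eq_left (boundaryLPP_nonneg hu ha le_rfl _ _)] at *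
    rw [ih, boundaryLPP]
  | case3 j ih =>
    rw [boundaryLPP_zero_right, max_eq_right (boundaryLPP_nonneg hu le_rfl hb _ _)] at *
    rw [ih, boundaryLPP]
  | case4 i j ih₁ ih₂ =>
    simp only [boundaryLPP, ih₁, ih₂, max_add_add_right]
    congr 1
    exact max_max_max_comm _ _ _ _

lemma boundaryLPP_convex_left (h0 : 0 ≤ θ) (h1 : θ ≤ 1) (i j : ℕ) :
    boundaryLPP (θ * a) 0 u i j
      ≤ (1 - θ) * boundaryLPP 0 0 u i j + θ * boundaryLPP a 0 u i j := by
  have h1' : 0 ≤ 1 - θ := by linarith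
  fun_induction boundaryLPP (θ * a) 0 u i j with
  | case1 => simp [boundaryLPP]
  | case2 i ih => simp only [boundaryLPP]; linarith
  | case3 j ih => simp only [boundaryLPP]; linarith
  | case4 i j ih₁ ih₂ =>
    simp only [boundaryLPP]
    suffices max (boundaryLPP (θ * a) 0 u i (j + 1)) (boundaryLPP (θ * a) 0 u (i + 1) j) ≤
        (1 - θ) * max (boundaryLPP 0 0 u i (j + 1)) (boundaryLPP 0 0 u (i + 1) j) +
        θ * max (boundaryLPP a 0 u i (j + 1)) (boundaryLPP a 0 u (i + 1) j) by linarith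
    refine max_le (ih₁.trans ?_) (ih₂.trans ?_)
    · gcongr <;> exact le_max_left _ _
    · gcongr <;> exact le_max_right _ _

lemma boundaryLPP_convex_right (h0 : 0 ≤ θ) (h1 : θ ≤ 1) (i j : ℕ) :
    boundaryLPP 0 (θ * b) u i j
      ≤ (1 - θ) * boundaryLPP 0 0 u i j + θ * boundaryLPP 0 b u i j := by
  have h1' : 0 ≤ 1 - θ := by linarith
  fun_induction boundaryLPP 0 (θ * b) u i j with
  | case1 => simp [boundaryLPP]
  | case2 i ih => simp only [boundaryLPP]; linarith
  | case3 j ih => simp only [boundaryLPP]; linarith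
  | case4 i j ih₁ ih₂ =>
    simp only [boundaryLPP]
    suffices max (boundaryLPP 0 (θ * b) u i (j + 1)) (boundaryLPP 0 (θ * b) u (i + 1) j) ≤
        (1 - θ) * max (boundaryLPP 0 0 u i (j + 1)) (boundaryLPP 0 0 u (i + 1) j) +
        θ * max (boundaryLPP 0 b u i (j + 1)) (boundaryLPP 0 b u (i + 1) j) by linarith
    refine max_le (ih₁.trans ?_) (ih₂.trans ?_)
    · gcongr <;> exact le_max_left _ _
    · gcongr <;> exact le_max_right _ _

/-- The cost of removing the boundary weights is controlled by the increase of the last-passage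
time when one of the boundary weights is enlarged. -/
lemma boundaryLPP_sub_le (hu : ∀ p, 0 ≤ u p) (ha : 0 ≤ a) (hb : 0 ≤ b) (ha' : 0 ≤ a')
    (hb' : 0 ≤ b') (h0 : 0 < θ) (h1 : θ ≤ 1) (i j : ℕ) :
    (1 - θ) * (boundaryLPP a b u i j - boundaryLPP 0 0 u i j) ≤
      θ * (max (boundaryLPP (a / θ) b' u i j - boundaryLPP a b u i j) 0
        + max (boundaryLPP a' (b / θ) u i j - boundaryLPP a b u i j) 0) := by
  have hA := boundaryLPP_convex_left (u := u) (a := a / θ) h0.le h1 i j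
  have hB := boundaryLPP_convex_right (u := u) (b := b / θ) h0.le h1 i j
  rw [mul_div_cancel₀ _ h0.ne'] at hA hB
  have hA' := boundaryLPP_mono hu (le_refl (a / θ)) hb' i j
  have hB' := boundaryLPP_mono hu ha' (le_refl (b / θ)) i j
  have m1 := le_max_left (boundaryLPP (a / θ) b' u i j - boundaryLPP a b u i j) 0
  have m2 := le_max_right (boundaryLPP (a / θ) b' u i j - boundaryLPP a b u i j) 0
  have m3 := le_max_left (boundaryLPP a' (b / θ) u i j - boundaryLPP a b u i j) 0
  have m4 := le_max_right (boundaryLPP a' (b / θ) u i j - boundaryLPP a b u i j) 0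
  rcases max_choice (boundaryLPP a 0 u i j) (boundaryLPP 0 b u i j) with h | h <;>
    rw [← boundaryLPP_eq_max hu ha hb] at h
  · rw [← h] at hA; nlinarith
  · rw [← h] at hB; nlinarith

lemma sum_le_boundaryLPP {π : ℕ → ℕ × ℕ} (h0 : π 0 = (1, 1)) (n : ℕ)
    (hstep : ∀ k, k < n →
      π (k + 1) = ((π k).1 + 1, (π k).2) ∨ π (k + 1) = ((π k).1, (π k).2 + 1)) :
    1 ≤ (π n).1 ∧ 1 ≤ (π n).2 ∧
      ∑ k ∈ Finset.range (n + 1), u (π k) ≤ boundaryLPP 0 0 u (π n).1 (π n).2 := by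
  induction n with
  | zero => simp [h0, boundaryLPP]
  | succ n ih =>
    obtain ⟨h1, h2, h3⟩ := ih fun k hk => hstep k (by omega)
    obtain ⟨i, hi⟩ := Nat.exists_eq_add_of_le' h1
    obtain ⟨j, hj⟩ := Nat.exists_eq_add_of_le' h2
    rw [hi, hj] at h3
    rw [Finset.sum_range_succ]
    rcases hstep n (by omega) with h | h <;> rw [hi, hj] at h <;> rw [h] <;>
      refine ⟨by simp, by simp, ?_⟩ <;> rw [boundaryLPP] <;> gcongr
    · exact h3.trans (le_max_left _ _)
    · exact h3.trans (le_max_right _ _)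

lemma exists_path_extend {M N M' N' : ℕ} {π : ℕ → ℕ × ℕ} (hM : 1 ≤ M) (hN : 1 ≤ N)
    (hπ : UpRightPath M N π)
    (h : (M', N') = (M + 1, N) ∨ (M', N') = (M, N + 1)) :
    ∃ π' : ℕ → ℕ × ℕ, UpRightPath M' N' π' ∧
      ∑ k ∈ Finset.range (M' + N' - 1), u (π' k) =
        ∑ k ∈ Finset.range (M + N - 1), u (π k) + u (M', N') := by
  have hs : M' + N' - 2 = M + N - 2 + 1 := by simp only [Prod.mk.injEq] at h; omega
  have hs' : M' + N' - 1 = M + N - 1 + 1 := by simp only [Prod.mk.injEq] at h; omega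
  have hs'' : M + N - 1 = M + N - 2 + 1 := by omega
  obtain ⟨h0, hend, hstep⟩ := hπ
  refine ⟨fun k => if k ≤ M + N - 2 then π k else (M', N'), ⟨by simpa using h0, ?_, ?_⟩, ?_⟩
  · rw [hs]; simp
  · intro k hk
    rw [hs] at hk
    rcases (Nat.lt_succ_iff_lt_or_eq.mp hk) with hk | rfl
    · simpa [hk.le, Nat.succ_le_of_lt hk] using hstep k hk
    · simpa [hend] using h
  · rw [hs', Finset.sum_range_succ, hs'']
    congr 1
    · refine Finset.sum_congr rfl fun k hk => ?_
      beta_reduce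
      rw [if_pos (by have := Finset.mem_range.mp hk; omega)]
    · simp

lemma exists_path_sum_eq (hu : ∀ p, 0 ≤ u p) (i j : ℕ) :
    ∃ π : ℕ → ℕ × ℕ, UpRightPath (i + 1) (j + 1) π ∧
      boundaryLPP 0 0 u (i + 1) (j + 1) =
        ∑ k ∈ Finset.range (i + 1 + (j + 1) - 1), u (π k) := by
  induction i generalizing j with
  | zero =>
    induction j with
    | zero => exact ⟨fun _ => (1, 1), by simp [UpRightPath], by simp [boundaryLPP]⟩
    | succ j ih =>
      obtain ⟨π, hπ, hs⟩ := ih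
      obtain ⟨π', hπ', hs'⟩ := exists_path_extend (u := u) (by omega) (by omega) hπ (Or.inr rfl)
      refine ⟨π', hπ', ?_⟩
      rw [hs', ← hs, boundaryLPP, boundaryLPP_zero_right,
        max_eq_right (boundaryLPP_nonneg hu le_rfl le_rfl _ _)]
  | succ i ihi =>
    have key : ∀ j, (∃ π : ℕ → ℕ × ℕ, UpRightPath (i + 1 + 1) (j + 1) π ∧
        boundaryLPP 0 0 u (i + 1) (j + 1) + u (i + 1 + 1, j + 1) =
          ∑ k ∈ Finset.range (i + 1 + 1 + (j + 1) - 1), u (π k)) := fun j => by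
      obtain ⟨π, hπ, hs⟩ := ihi j
      obtain ⟨π', hπ', hs'⟩ := exists_path_extend (u := u) (by omega) (by omega) hπ (Or.inl rfl)
      exact ⟨π', hπ', by rw [hs', ← hs]⟩
    induction j with
    | zero =>
      obtain ⟨π, hπ, hs⟩ := key 0
      refine ⟨π, hπ, ?_⟩
      rw [← hs, boundaryLPP, boundaryLPP_zero_left,
        max_eq_left (boundaryLPP_nonneg hu le_rfl le_rfl _ _)]
    | succ j ihj =>
      rw [boundaryLPP]
      rcases max_choice (boundaryLPP 0 0 u (i + 1) (j + 1 + 1))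
        (boundaryLPP 0 0 u (i + 1 + 1) (j + 1)) with h | h <;> rw [h]
      · exact key (j + 1)
      · obtain ⟨π, hπ, hs⟩ := ihj
        obtain ⟨π', hπ', hs'⟩ := exists_path_extend (u := u) (by omega) (by omega) hπ (Or.inr rfl)
        exact ⟨π', hπ', by rw [hs', ← hs]⟩

/-- Without boundary weights, `boundaryLPP` is the maximum over up/right paths. -/
lemma lppSupR_eq_boundaryLPP (hu : ∀ p, 0 ≤ u p) {M N : ℕ} (hM : 1 ≤ M) (hN : 1 ≤ N) :
    lppSupR u M N = boundaryLPP 0 0 u M N := by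
  obtain ⟨i, rfl⟩ := Nat.exists_eq_add_of_le' hM
  obtain ⟨j, rfl⟩ := Nat.exists_eq_add_of_le' hN
  refine IsGreatest.csSup_eq ⟨exists_path_sum_eq hu i j, ?_⟩
  rintro s ⟨π, ⟨h0, hend, hstep⟩, rfl⟩
  have := (sum_le_boundaryLPP (u := u) h0 _ hstep).2.2
  rwa [hend, show i + 1 + (j + 1) - 2 + 1 = i + 1 + (j + 1) - 1 by omega] at this

end Deterministic

section Burke

open ProbabilityTheory Measure

/-- The local rule of last-passage percolation, acting on a horizontal increment, a vertical
increment and a bulk weight. -/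
noncomputable def cornerFlip (p : ℝ × ℝ × ℝ) : ℝ × ℝ × ℝ :=
  (p.2.2 + max (p.1 - p.2.1) 0, p.2.2 + max (p.2.1 - p.1) 0, min p.1 p.2.1)

lemma measurable_cornerFlip : Measurable cornerFlip := by
  unfold cornerFlip; fun_prop

lemma measurePreserving_cornerFlip_volume :
    MeasurePreserving cornerFlip (volume : Measure (ℝ × ℝ × ℝ)) volume := by
  have shear : ∀ g : ℝ → ℝ, Measurable g →
      MeasurePreserving (fun p : ℝ × ℝ => (p.1, p.2 + g p.1)) volume volume := fun g hg =>
    (MeasurePreserving.id volume).skew_product (g := fun x y => y + g x)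
      (by unfold Function.uncurry; fun_prop)
      (Filter.Eventually.of_forall fun x => (measurePreserving_add_right volume (g x)).map_eq)
  have sub : MeasurePreserving (fun p : ℝ × ℝ => (p.1 - p.2, p.2)) volume volume := by
    have := (measurePreserving_swap (μ := (volume : Measure ℝ)) (ν := (volume : Measure ℝ))).comp
      ((shear (fun x => -x) measurable_neg).comp
        (measurePreserving_swap (μ := (volume : Measure ℝ)) (ν := (volume : Measure ℝ))))
    convert! this using 1
  have add : MeasurePreserving (fun p : ℝ × ℝ => (p.1 + p.2, p.2)) volume volume := by
    have := (measurePreserving_swap (μ := (volume : Measure ℝ)) (ν := (volume : Measure ℝ))).comp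
      ((shear (fun x => x) measurable_id).comp
        (measurePreserving_swap (μ := (volume : Measure ℝ)) (ν := (volume : Measure ℝ))))
    convert! this using 1
  have hassoc := measurePreserving_prodAssoc (volume : Measure ℝ) (volume : Measure ℝ)
    (volume : Measure ℝ)
  have lift : ∀ {f : ℝ × ℝ → ℝ × ℝ}, MeasurePreserving f volume volume →
      MeasurePreserving (fun p : ℝ × ℝ × ℝ =>
        ((f (p.1, p.2.1)).1, (f (p.1, p.2.1)).2, p.2.2)) volume volume := fun {f} hf => by
    have := hassoc.comp ((hf.prod (MeasurePreserving.id (volume : Measure ℝ))).comp hassoc.symm)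
    convert! this using 1
  have swap : MeasurePreserving (fun p : ℝ × ℝ × ℝ => (p.1, p.2.2, p.2.1)) volume volume := by
    have := (MeasurePreserving.id (volume : Measure ℝ)).prod
      (measurePreserving_swap (μ := (volume : Measure ℝ)) (ν := (volume : Measure ℝ)))
    convert! this using 1
  have := (lift add).comp <| (lift (shear (fun d => -min d 0) (by fun_prop))).comp <|
    swap.comp <| (lift (shear (fun d => min d 0) (by fun_prop))).comp (lift sub)
  convert! this using 1
  ext ⟨x, y, z⟩ <;> simp only [cornerFlip, Function.comp] <;>
    rcases le_total x y with h | h <;> simp [h] <;> ring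

lemma expMeasure_eq (r : ℝ) : expMeasure r = volume.withDensity (exponentialPDF r) := rfl

lemma measurable_exponentialPDF (r : ℝ) : Measurable (exponentialPDF r) :=
  (measurable_exponentialPDFReal r).ennreal_ofReal

lemma prod_exponentialPDF_cornerFlip {α β : ℝ} (hα : 0 < α) (hβ : 0 < β) (p : ℝ × ℝ × ℝ) :
    exponentialPDF α (cornerFlip p).1 * (exponentialPDF β (cornerFlip p).2.1 *
        exponentialPDF (α + β) (cornerFlip p).2.2) =
      exponentialPDF α p.1 * (exponentialPDF β p.2.1 * exponentialPDF (α + β) p.2.2) := by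
  obtain ⟨x, y, z⟩ := p
  simp only [cornerFlip]
  by_cases hx : 0 ≤ x; swap
  · rw [exponentialPDF_of_neg (not_le.mp hx), exponentialPDF_of_neg (x := min x y)]
    · simp
    · exact min_lt_of_left_lt (not_le.mp hx)
  by_cases hy : 0 ≤ y; swap
  · rw [exponentialPDF_of_neg (not_le.mp hy), exponentialPDF_of_neg (x := min x y)]
    · simp
    · exact min_lt_of_right_lt (not_le.mp hy)
  by_cases hz : 0 ≤ z; swap
  · rw [exponentialPDF_of_neg (not_le.mp hz)]
    rcases le_total x y with h | h
    · rw [max_eq_right (sub_nonpos.mpr h), add_zero, exponentialPDF_of_neg (not_le.mp hz)]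
      simp
    · rw [max_eq_right (sub_nonpos.mpr h), add_zero, exponentialPDF_of_neg (not_le.mp hz)]
      simp
  have hαβ : 0 < α + β := add_pos hα hβ
  rw [exponentialPDF_of_nonneg hx, exponentialPDF_of_nonneg hy, exponentialPDF_of_nonneg hz,
    exponentialPDF_of_nonneg (le_min hx hy),
    exponentialPDF_of_nonneg (add_nonneg hz (le_max_right _ _)),
    exponentialPDF_of_nonneg (add_nonneg hz (le_max_right _ _))]
  repeat rw [← ENNReal.ofReal_mul (by positivity)]
  congr 1
  have key : ∀ s t v : ℝ, α * Real.exp (-(α * s)) * (β * Real.exp (-(β * t)) *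
      ((α + β) * Real.exp (-((α + β) * v)))) =
      α * β * (α + β) * Real.exp (-(α * s) + -(β * t) + -((α + β) * v)) := by
    intro s t v; rw [Real.exp_add, Real.exp_add]; ring
  rw [key, key]
  congr 2
  rcases le_total x y with h | h <;> simp [h] <;> ring

lemma measurePreserving_cornerFlip {α β : ℝ} (hα : 0 < α) (hβ : 0 < β) :
    MeasurePreserving cornerFlip
      ((expMeasure α).prod ((expMeasure β).prod (expMeasure (α + β))))
      ((expMeasure α).prod ((expMeasure β).prod (expMeasure (α + β)))) := by
  have := isProbabilityMeasure_expMeasure hα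
  have := isProbabilityMeasure_expMeasure hβ
  have := isProbabilityMeasure_expMeasure (add_pos hα hβ)
  have h : (expMeasure α).prod ((expMeasure β).prod (expMeasure (α + β))) =
      (volume : Measure (ℝ × ℝ × ℝ)).withDensity (fun p =>
        exponentialPDF α p.1 * (exponentialPDF β p.2.1 * exponentialPDF (α + β) p.2.2)) := by
    simp only [expMeasure_eq] at *
    rw [prod_withDensity (measurable_exponentialPDF _) (measurable_exponentialPDF _),
      prod_withDensity (measurable_exponentialPDF _)]
    · rfl
    · exact ((measurable_exponentialPDF _).comp measurable_fst).mul
        ((measurable_exponentialPDF _).comp measurable_snd)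
  rw [h]
  have hm : Measurable (fun p : ℝ × ℝ × ℝ =>
      exponentialPDF α p.1 * (exponentialPDF β p.2.1 * exponentialPDF (α + β) p.2.2)) :=
    ((measurable_exponentialPDF _).comp measurable_fst).mul
      (((measurable_exponentialPDF _).comp (measurable_fst.comp measurable_snd)).mul
        ((measurable_exponentialPDF _).comp (measurable_snd.comp measurable_snd)))
  refine ⟨measurable_cornerFlip, Measure.ext fun s hs => ?_⟩
  rw [map_apply measurable_cornerFlip hs, withDensity_apply _ (measurable_cornerFlip hs),
    withDensity_apply _ hs,
    ← measurePreserving_cornerFlip_volume.setLIntegral_comp_preimage hs hm]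
  exact lintegral_congr fun p => (prod_exponentialPDF_cornerFlip hα hβ p).symm

end Burke

section Families

open ProbabilityTheory Measure

variable {Ω ι : Type*} [MeasurableSpace Ω]

/-- A family of independent exponential random variables with rates `r`. -/
structure IsExpFamily (r : ι → ℝ) (X : ι → Ω → ℝ) (P : Measure Ω) : Prop where
  measurable : ∀ i, Measurable (X i)
  indep : iIndepFun X P
  map_eq : ∀ i, P.map (X i) = expMeasure (r i)

/-- Apply `cornerFlip` to the coordinates `a`, `b`, `c` of a family of functions. -/
noncomputable def flipAt [DecidableEq ι] (a b c : ι) (X : ι → Ω → ℝ) (i : ι) (ω : Ω) : ℝ :=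
  if i = a then (cornerFlip (X a ω, X b ω, X c ω)).1
  else if i = b then (cornerFlip (X a ω, X b ω, X c ω)).2.1
  else if i = c then (cornerFlip (X a ω, X b ω, X c ω)).2.2
  else X i ω

/-- Burke's property: the local rule preserves families of independent exponentials. -/
lemma IsExpFamily.flipAt [DecidableEq ι] {P : Measure Ω} [IsProbabilityMeasure P] {r : ι → ℝ}
    {X : ι → Ω → ℝ} (hX : IsExpFamily r X P) {a b c : ι} (hab : a ≠ b) (hac : a ≠ c)
    (hbc : b ≠ c) (ha : 0 < r a) (hb : 0 < r b) (hc : r c = r a + r b) :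
    IsExpFamily r (flipAt a b c X) P := by
  have := isProbabilityMeasure_expMeasure ha
  have := isProbabilityMeasure_expMeasure hb
  have := isProbabilityMeasure_expMeasure (add_pos ha hb)
  obtain ⟨hm, hi, hl⟩ := hX
  set Z : Ω → ℝ × ℝ × ℝ := fun ω => (X a ω, X b ω, X c ω) with hZ
  have hZm : Measurable Z := (hm a).prodMk ((hm b).prodMk (hm c))
  have hZ'm : Measurable fun ω => cornerFlip (Z ω) := measurable_cornerFlip.comp hZm
  have hZlaw : P.map Z = (expMeasure (r a)).prod ((expMeasure (r b)).prod
      (expMeasure (r a + r b))) := by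
    have h1 := (hi.indepFun_prodMk hm b c a hab.symm hac.symm).symm
    have h2 := hi.indepFun hbc
    rw [hZ, h1.map_prod_eq_prod_map_map (hm a).aemeasurable
      ((hm b).prodMk (hm c)).aemeasurable, h2.map_prod_eq_prod_map_map (hm b).aemeasurable
      (hm c).aemeasurable, hl, hl, hl, hc]
  have hZ'law : P.map (fun ω => cornerFlip (Z ω)) = (expMeasure (r a)).prod
      ((expMeasure (r b)).prod (expMeasure (r a + r b))) := by
    rw [← (measurePreserving_cornerFlip ha hb).map_eq, ← hZlaw,
      map_map measurable_cornerFlip hZm]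
    rfl
  have fa : ∀ ω, _root_.flipAt a b c X a ω = (cornerFlip (Z ω)).1 := fun ω => by
    simp [_root_.flipAt, hZ]
  have fb : ∀ ω, _root_.flipAt a b c X b ω = (cornerFlip (Z ω)).2.1 := fun ω => by
    simp [_root_.flipAt, hZ, hab.symm]
  have fc : ∀ ω, _root_.flipAt a b c X c ω = (cornerFlip (Z ω)).2.2 := fun ω => by
    simp [_root_.flipAt, hZ, hac.symm, hbc.symm]
  have fo : ∀ i, i ≠ a → i ≠ b → i ≠ c → _root_.flipAt a b c X i = X i := fun i h1 h2 h3 => by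
    ext ω; simp [_root_.flipAt, h1, h2, h3]
  have hm' : ∀ i, Measurable (_root_.flipAt a b c X i) := fun i => by
    by_cases h1 : i = a
    · subst h1; rw [funext fa]; exact hZ'm.fst
    by_cases h2 : i = b
    · subst h2; rw [funext fb]; exact hZ'm.snd.fst
    by_cases h3 : i = c
    · subst h3; rw [funext fc]; exact hZ'm.snd.snd
    rw [fo i h1 h2 h3]; exact hm i
  have hl' : ∀ i, P.map (_root_.flipAt a b c X i) = expMeasure (r i) := fun i => by
    by_cases h1 : i = a
    · subst h1
      rw [funext fa, show (fun ω => (cornerFlip (Z ω)).1) = Prod.fst ∘ fun ω => cornerFlip (Z ω)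
        from rfl, ← map_map measurable_fst hZ'm, hZ'law, Measure.map_fst_prod, measure_univ, one_smul]
    by_cases h2 : i = b
    · subst h2
      rw [funext fb, show (fun ω => (cornerFlip (Z ω)).2.1) = Prod.fst ∘ Prod.snd ∘
        fun ω => cornerFlip (Z ω) from rfl, ← map_map measurable_fst (measurable_snd.comp hZ'm),
        ← map_map measurable_snd hZ'm, hZ'law, Measure.map_snd_prod, measure_univ, one_smul,
        Measure.map_fst_prod, measure_univ, one_smul]
    by_cases h3 : i = c
    · subst h3
      rw [funext fc, show (fun ω => (cornerFlip (Z ω)).2.2) = Prod.snd ∘ Prod.snd ∘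
        fun ω => cornerFlip (Z ω) from rfl, ← map_map measurable_snd (measurable_snd.comp hZ'm),
        ← map_map measurable_snd hZ'm, hZ'law, Measure.map_snd_prod, measure_univ, one_smul,
        Measure.map_snd_prod, measure_univ, one_smul, hc]
    rw [fo i h1 h2 h3, hl i]
  refine ⟨hm', ?_, hl'⟩
  rw [iIndepFun_iff_measure_inter_preimage_eq_mul]
  intro S B hB
  set Y := _root_.flipAt a b c X
  let B' : ι → Set ℝ := fun i => if i ∈ S then B i else Set.univ
  have hB' : ∀ i, MeasurableSet (B' i) := fun i => by
    by_cases h : i ∈ S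
    · simpa [B', h] using hB i h
    · simp [B', h]
  let T : Finset ι := S \ {a, b, c}
  have haT : a ∉ T := by simp [T]
  have hbT : b ∉ T := by simp [T]
  have hcT : c ∉ T := by simp [T]
  have hsub : S ⊆ insert a (insert b (insert c T)) := fun i hi => by
    simp only [T, Finset.mem_insert, Finset.mem_sdiff, Finset.mem_singleton]; tauto
  have e1 : ⋂ i ∈ S, Y i ⁻¹' B i =
      (fun ω => cornerFlip (Z ω)) ⁻¹' (B' a ×ˢ (B' b ×ˢ B' c)) ∩ ⋂ i ∈ T, X i ⁻¹' B' i := by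
    have : ⋂ i ∈ S, Y i ⁻¹' B i = ⋂ i ∈ insert a (insert b (insert c T)), Y i ⁻¹' B' i := by
      ext ω
      simp only [Set.mem_iInter, Set.mem_preimage]
      constructor
      · intro h i _
        by_cases hi : i ∈ S
        · simpa [B', hi] using h i hi
        · simp [B', hi]
      · intro h i hi
        simpa [B', hi] using h i (hsub hi)
    rw [this]
    simp only [Finset.set_biInter_insert]
    ext ω
    have hT : (∀ i ∈ T, Y i ω ∈ B' i) ↔ (∀ i ∈ T, X i ω ∈ B' i) := by
      refine forall₂_congr fun i hi => ?_
      rw [fo i (fun h => haT (h ▸ hi)) (fun h => hbT (h ▸ hi)) (fun h => hcT (h ▸ hi))]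
    simp only [Set.mem_inter_iff, Set.mem_iInter, Set.mem_preimage, Set.mem_prod, hT, fa, fb,
      fc, and_assoc]
  have e2 : ∏ i ∈ S, P (Y i ⁻¹' B i) =
      ∏ i ∈ insert a (insert b (insert c T)), P (Y i ⁻¹' B' i) := by
    rw [← Finset.prod_subset hsub]
    · exact Finset.prod_congr rfl fun i hi => by simp [B', hi]
    · intro i _ hi; simp [B', hi]
  have hind : IndepFun (fun ω => cornerFlip (Z ω)) (fun ω (i : T) => X i ω) P := by
    have h := hi.indepFun_finset {a, b, c} T
      (by simp [Finset.disjoint_insert_left, haT, hbT, hcT]) hm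
    exact h.comp (φ := fun x : (({a, b, c} : Finset ι) → ℝ) => cornerFlip
      (x ⟨a, by simp⟩, x ⟨b, by simp⟩, x ⟨c, by simp⟩)) (ψ := id)
      (measurable_cornerFlip.comp (by fun_prop)) measurable_id
  have e3 := hind.measure_inter_preimage_eq_mul (B' a ×ˢ (B' b ×ˢ B' c))
    (Set.univ.pi fun i : T => B' i) ((hB' a).prod ((hB' b).prod (hB' c)))
    (MeasurableSet.univ_pi fun i => hB' i)
  have e4 : (fun ω (i : T) => X i ω) ⁻¹' (Set.univ.pi fun i : T => B' i) =
      ⋂ i ∈ T, X i ⁻¹' B' i := by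
    ext ω; simp
  rw [e4, hi.measure_inter_preimage_eq_mul T fun i _ => hB' i, ← map_apply hZ'm
    ((hB' a).prod ((hB' b).prod (hB' c))), hZ'law, prod_prod, prod_prod, ← hc, ← hl' a, ← hl' b,
    ← hl' c, map_apply (hm' a) (hB' a), map_apply (hm' b) (hB' b), map_apply (hm' c) (hB' c)] at e3
  rw [e1, e3, e2, Finset.prod_insert (by simp [hab, hac, haT]),
    Finset.prod_insert (by simp [hbc, hbT]), Finset.prod_insert hcT]
  have : ∏ i ∈ T, P (Y i ⁻¹' B' i) = ∏ i ∈ T, P (X i ⁻¹' B' i) :=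
    Finset.prod_congr rfl fun i hi => by
      rw [fo i (fun h => haT (h ▸ hi)) (fun h => hbT (h ▸ hi)) (fun h => hcT (h ▸ hi))]
  rw [this]
  ring

lemma IsExpFamily.ae_nonneg {P : Measure Ω} {r : ι → ℝ} {X : ι → Ω → ℝ}
    (hX : IsExpFamily r X P) (i : ι) : ∀ᵐ ω ∂P, 0 ≤ X i ω := by
  refine ae_of_ae_map (p := fun x => 0 ≤ x) (hX.measurable i).aemeasurable ?_
  rw [hX.map_eq, expMeasure_eq, ae_withDensity_iff (measurable_exponentialPDF _)]
  refine Filter.Eventually.of_forall fun x hx => ?_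
  by_contra h
  exact hx (exponentialPDF_of_neg (not_le.mp h))

end Families

section Moments

open ProbabilityTheory Measure

variable {Ω ι : Type*} [MeasurableSpace Ω] {P : Measure Ω}

lemma lintegral_pow_expMeasure {r : ℝ} (hr : 0 < r) (n : ℕ) :
    ∫⁻ x, ENNReal.ofReal (x ^ n) ∂(expMeasure r) = ENNReal.ofReal (n.factorial / r ^ n) := by
  rw [expMeasure_eq, lintegral_withDensity_eq_lintegral_mul _ (measurable_exponentialPDF r)
    (by fun_prop)]
  have h : ∀ x, (exponentialPDF r * fun x => ENNReal.ofReal (x ^ n)) x =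
      ENNReal.ofReal (n.factorial / r ^ n) * gammaPDF (n + 1) r x := fun x => by
    rcases lt_or_ge x 0 with hx | hx
    · simp [exponentialPDF_of_neg hx, gammaPDF_of_neg hx]
    · rw [Pi.mul_apply, exponentialPDF_of_nonneg hx, gammaPDF_of_nonneg hx,
        ← ENNReal.ofReal_mul (by positivity), ← ENNReal.ofReal_mul (by positivity),
        Real.Gamma_nat_eq_factorial, add_sub_cancel_right, Real.rpow_natCast,
        Real.rpow_add_one hr.ne', Real.rpow_natCast]
      congr 1
      have : (n.factorial : ℝ) ≠ 0 := by positivity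
      field_simp
  simp_rw [h]
  have hg : Measurable (gammaPDF (n + 1) r) := (measurable_gammaPDFReal _ _).ennreal_ofReal
  rw [lintegral_const_mul _ hg, lintegral_gammaPDF_eq_one (by positivity) hr, mul_one]

lemma IsExpFamily.lintegral_pow {r : ι → ℝ} {X : ι → Ω → ℝ} (hX : IsExpFamily r X P) {i : ι}
    (hr : 0 < r i) (n : ℕ) :
    ∫⁻ ω, ENNReal.ofReal (X i ω ^ n) ∂P = ENNReal.ofReal (n.factorial / r i ^ n) := by
  rw [← lintegral_pow_expMeasure hr, ← hX.map_eq, lintegral_map (by fun_prop) (hX.measurable i)]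

lemma IsExpFamily.integrable_pow {r : ι → ℝ} {X : ι → Ω → ℝ} (hX : IsExpFamily r X P) {i : ι}
    (hr : 0 < r i) (n : ℕ) : Integrable (fun ω => X i ω ^ n) P := by
  refine ⟨((hX.measurable i).pow_const n).aestronglyMeasurable, ?_⟩
  rw [hasFiniteIntegral_iff_ofReal ((hX.ae_nonneg i).mono fun ω h => pow_nonneg h n),
    hX.lintegral_pow hr]
  exact ENNReal.ofReal_lt_top

lemma IsExpFamily.integral_pow {r : ι → ℝ} {X : ι → Ω → ℝ} (hX : IsExpFamily r X P) {i : ι}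
    (hr : 0 < r i) (n : ℕ) : ∫ ω, X i ω ^ n ∂P = n.factorial / r i ^ n := by
  rw [integral_eq_lintegral_of_nonneg_ae ((hX.ae_nonneg i).mono fun ω h => pow_nonneg h n)
    ((hX.measurable i).pow_const n).aestronglyMeasurable, hX.lintegral_pow hr,
    ENNReal.toReal_ofReal (by positivity)]

lemma IsExpFamily.memLp_two {r : ι → ℝ} {X : ι → Ω → ℝ} (hX : IsExpFamily r X P) {i : ι}
    (hr : 0 < r i) : MemLp (X i) 2 P :=
  (memLp_two_iff_integrable_sq (hX.measurable i).aestronglyMeasurable).mpr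
    (hX.integrable_pow hr 2)

lemma IsExpFamily.integral_eq {r : ι → ℝ} {X : ι → Ω → ℝ} (hX : IsExpFamily r X P) {i : ι}
    (hr : 0 < r i) : ∫ ω, X i ω ∂P = (r i)⁻¹ := by
  simpa using hX.integral_pow hr 1

lemma IsExpFamily.variance_eq [IsProbabilityMeasure P] {r : ι → ℝ} {X : ι → Ω → ℝ}
    (hX : IsExpFamily r X P) {i : ι} (hr : 0 < r i) :
    variance (X i) P = (r i)⁻¹ ^ 2 := by
  rw [variance_eq_sub (hX.memLp_two hr), hX.integral_eq hr]
  have := hX.integral_pow hr 2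
  simp only [Pi.pow_apply, this]
  simp; field_simp; norm_num

lemma integral_abs_sub_le_sqrt_variance [IsProbabilityMeasure P] {Y : Ω → ℝ} (hY : MemLp Y 2 P) :
    ∫ ω, |Y ω - ∫ ω', Y ω' ∂P| ∂P ≤ Real.sqrt (variance Y P) := by
  set m := ∫ ω', Y ω' ∂P
  have hZ : MemLp (fun ω => |Y ω - m|) 2 P := (hY.sub (memLp_const m)).abs
  refine Real.le_sqrt_of_sq_le ?_
  have h := variance_nonneg (fun ω => |Y ω - m|) P
  rw [variance_eq_sub hZ] at h
  rw [variance_eq_integral hY.aestronglyMeasurable.aemeasurable]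
  simp only [Pi.pow_apply, sq_abs] at h
  linarith

lemma IsExpFamily.sum_bounds [IsProbabilityMeasure P] {r : ι → ℝ} {X : ι → Ω → ℝ}
    (hX : IsExpFamily r X P) {ρ : ℝ} (hρ : 0 < ρ) {n : ℕ} (e : ℕ → ι) (he : Function.Injective e)
    (hr : ∀ k, r (e k) = ρ) :
    Integrable (fun ω => ∑ k ∈ Finset.range n, X (e k) ω) P ∧
    ∫ ω, ∑ k ∈ Finset.range n, X (e k) ω ∂P = n / ρ ∧
    ∫ ω, |∑ k ∈ Finset.range n, X (e k) ω - n / ρ| ∂P ≤ Real.sqrt n / ρ := by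
  have hL : ∀ k, MemLp (X (e k)) 2 P := fun k => hX.memLp_two (by rwa [hr])
  have hI : ∀ k, Integrable (X (e k)) P := fun k => (hL k).integrable (by norm_num)
  have hint : ∫ ω, ∑ k ∈ Finset.range n, X (e k) ω ∂P = n / ρ := by
    rw [integral_finsetSum _ fun k _ => hI k]
    simp [hX.integral_eq, hr, hρ, div_eq_mul_inv]
  have hS : MemLp (fun ω => ∑ k ∈ Finset.range n, X (e k) ω) 2 P :=
    memLp_finsetSum _ fun k _ => hL k
  refine ⟨integrable_finsetSum _ fun k _ => hI k, hint, ?_⟩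
  have h := integral_abs_sub_le_sqrt_variance hS
  rw [hint] at h
  have hv : variance (fun ω => ∑ k ∈ Finset.range n, X (e k) ω) P = n * ρ⁻¹ ^ 2 := by
    rw [← Finset.sum_fn, IndepFun.variance_sum (fun k _ => hL k)
      (fun i _ j _ hij => hX.indep.indepFun (he.ne hij))]
    simp [hX.variance_eq, hr, hρ]
  rwa [hv, Real.sqrt_mul (by positivity), Real.sqrt_sq (by positivity), ← div_eq_mul_inv] at h

lemma map_eq_expMeasure_s6 [IsProbabilityMeasure P] {Y : Ω → ℝ} (hY : Measurable Y) {r : ℝ}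
    (hr : 0 < r) (h : ∀ t, 0 ≤ t → P {ω | Y ω ≤ t} = ENNReal.ofReal (1 - Real.exp (-(r * t)))) :
    P.map Y = expMeasure r := by
  have := isProbabilityMeasure_expMeasure hr
  have := isProbabilityMeasure_map (μ := P) hY.aemeasurable
  refine Measure.eq_of_cdf _ _ (StieltjesFunction.ext fun t => ?_)
  rw [cdf_expMeasure_eq hr, cdf_eq_real, map_measureReal_apply hY measurableSet_Iic]
  change (P {ω | Y ω ≤ t}).toReal = _
  split_ifs with ht
  · rw [h t ht, ENNReal.toReal_ofReal]
    rw [sub_nonneg, Real.exp_le_one_iff]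
    have := mul_nonneg hr.le ht
    linarith
  · have h0 : P {ω | Y ω ≤ 0} = 0 := by rw [h 0 le_rfl]; simp
    have h1 : P {ω | Y ω ≤ t} = 0 :=
      measure_mono_null (fun ω (hω : Y ω ≤ t) => hω.trans (not_le.mp ht).le) h0
    rw [h1, ENNReal.toReal_zero]

end Moments

section Stationary

open ProbabilityTheory Measure

variable {Ω : Type*} [MeasurableSpace Ω] {P : Measure Ω} [IsProbabilityMeasure P]
  {u : ℕ × ℕ → Ω → ℝ}

/-- Rates of the stationary weights: `α` on the horizontal axis, `β` on the vertical axis and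
`1` elsewhere. -/
noncomputable def axisRate (α β : ℝ) : ℕ × ℕ → ℝ
  | (_ + 1, 0) => α
  | (0, _ + 1) => β
  | _ => 1

lemma isExpFamily_axis (hmeas : ∀ p, Measurable (u p)) (hindep : iIndepFun u P)
    (hexp : ∀ p t, 0 ≤ t → P {ω | u p ω ≤ t} = ENNReal.ofReal (1 - Real.exp (-t)))
    {α β : ℝ} (hα : 0 < α) (hβ : 0 < β) :
    IsExpFamily (axisRate α β) (fun p ω => (axisRate α β p)⁻¹ * u p ω) P := by
  have hpos : ∀ p, 0 < axisRate α β p := by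
    rintro ⟨_ | i, _ | j⟩ <;> simp [axisRate, hα, hβ]
  refine ⟨fun p => (hmeas p).const_mul _, hindep.comp (fun p x => (axisRate α β p)⁻¹ * x)
    (fun p => measurable_const_mul _), fun p => map_eq_expMeasure_s6 ((hmeas p).const_mul _)
      (hpos p) fun t ht => ?_⟩
  rw [← hexp p _ (mul_nonneg (hpos p).le ht)]
  congr 1
  ext ω
  exact inv_mul_le_iff₀ (hpos p)

lemma boundaryLPP_succ_sub_up (a b : ℝ) (u : ℕ × ℕ → ℝ) (i j : ℕ) :
    boundaryLPP a b u (i + 1) (j + 1) - boundaryLPP a b u i (j + 1) = u (i + 1, j + 1) +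
      max ((boundaryLPP a b u (i + 1) j - boundaryLPP a b u i j) -
        (boundaryLPP a b u i (j + 1) - boundaryLPP a b u i j)) 0 := by
  rw [boundaryLPP]
  rcases le_total (boundaryLPP a b u i (j + 1)) (boundaryLPP a b u (i + 1) j) with h | h <;>
    simp [h]
  ring

lemma boundaryLPP_succ_sub_right (a b : ℝ) (u : ℕ × ℕ → ℝ) (i j : ℕ) :
    boundaryLPP a b u (i + 1) (j + 1) - boundaryLPP a b u (i + 1) j = u (i + 1, j + 1) +
      max ((boundaryLPP a b u i (j + 1) - boundaryLPP a b u i j) -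
        (boundaryLPP a b u (i + 1) j - boundaryLPP a b u i j)) 0 := by
  rw [boundaryLPP]
  rcases le_total (boundaryLPP a b u i (j + 1)) (boundaryLPP a b u (i + 1) j) with h | h <;>
    simp [h]
  ring

/-- The state of the stationary model once the columns up to `i` have been processed up to height
`N` and column `i + 1` up to height `j`. -/
structure IsStage (a b : ℝ) (N i j : ℕ) (u X : ℕ × ℕ → ℝ) : Prop where
  done : ∀ l < j, X (0, l + 1) = boundaryLPP a b u (i + 1) (l + 1) - boundaryLPP a b u (i + 1) l
  todo : ∀ l < N, j ≤ l → X (0, l + 1) = boundaryLPP a b u i (l + 1) - boundaryLPP a b u i l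
  horizontal : X (i + 1, 0) = boundaryLPP a b u (i + 1) j - boundaryLPP a b u i j
  axis : ∀ k, i < k → X (k + 1, 0) = a * u (k + 1, 0)
  bulk : ∀ k l, i < k ∨ (i = k ∧ j ≤ l) → X (k + 1, l + 1) = u (k + 1, l + 1)

lemma exists_isStage (hmeas : ∀ p, Measurable (u p)) (hindep : iIndepFun u P)
    (hexp : ∀ p t, 0 ≤ t → P {ω | u p ω ≤ t} = ENNReal.ofReal (1 - Real.exp (-t)))
    {α β : ℝ} (hα : 0 < α) (hβ : 0 < β) (hαβ : α + β = 1) (N i j : ℕ) (hj : j ≤ N) :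
    ∃ X : ℕ × ℕ → Ω → ℝ, IsExpFamily (axisRate α β) X P ∧
      ∀ ω, IsStage α⁻¹ β⁻¹ N i j (fun p => u p ω) (fun p => X p ω) := by
  have next : ∀ i j, j < N → (∃ X : ℕ × ℕ → Ω → ℝ, IsExpFamily (axisRate α β) X P ∧
      ∀ ω, IsStage α⁻¹ β⁻¹ N i j (fun p => u p ω) (fun p => X p ω)) →
      ∃ X : ℕ × ℕ → Ω → ℝ, IsExpFamily (axisRate α β) X P ∧
      ∀ ω, IsStage α⁻¹ β⁻¹ N i (j + 1) (fun p => u p ω) (fun p => X p ω) := by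
    rintro i j hj ⟨X, hX, hst⟩
    refine ⟨flipAt (i + 1, 0) (0, j + 1) (i + 1, j + 1) X,
      hX.flipAt (by simp) (by simp) (by simp) (by simpa [axisRate]) (by simpa [axisRate])
        (by simp [axisRate, hαβ]), fun ω => ?_⟩
    obtain ⟨h1, h2, h3, h4, h5⟩ := hst ω
    have h2j := h2 j hj le_rfl
    have h5j := h5 i j (Or.inr ⟨rfl, le_rfl⟩)
    constructor
    · intro l hl
      rcases Nat.lt_succ_iff_lt_or_eq.mp hl with hl | rfl
      · simpa [flipAt, hl.ne] using h1 l hl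
      · rw [boundaryLPP_succ_sub_right, ← h3, ← h2j, ← h5j]
        simp [flipAt, cornerFlip]
    · intro l hl hjl
      simpa [flipAt, (Nat.lt_of_succ_le hjl).ne'] using h2 l hl (by omega)
    · rw [boundaryLPP_succ_sub_up, ← h3, ← h2j, ← h5j]
      simp [flipAt, cornerFlip]
    · intro k hk
      simpa [flipAt, hk.ne'] using h4 k hk
    · intro k l hkl
      have hne : ¬(k = i ∧ l = j) := by omega
      simpa [flipAt, hne] using h5 k l (by omega)
  have column : ∀ i, (∃ X : ℕ × ℕ → Ω → ℝ, IsExpFamily (axisRate α β) X P ∧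
      ∀ ω, IsStage α⁻¹ β⁻¹ N i 0 (fun p => u p ω) (fun p => X p ω)) → ∀ j ≤ N,
      ∃ X : ℕ × ℕ → Ω → ℝ, IsExpFamily (axisRate α β) X P ∧
      ∀ ω, IsStage α⁻¹ β⁻¹ N i j (fun p => u p ω) (fun p => X p ω) := by
    intro i h0 j
    induction j with
    | zero => exact fun _ => h0
    | succ j ih => exact fun hj => next i j (by omega) (ih (by omega))
  refine column i ?_ j hj
  clear hj j
  induction i with
  | zero =>
    refine ⟨_, isExpFamily_axis hmeas hindep hexp hα hβ, fun ω => ⟨?_, ?_, ?_, ?_, ?_⟩⟩ <;>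
      simp [axisRate, boundaryLPP]
  | succ i ih =>
    obtain ⟨X, hX, hst⟩ := column i ih N le_rfl
    refine ⟨X, hX, fun ω => ?_⟩
    obtain ⟨h1, h2, h3, h4, h5⟩ := hst ω
    refine ⟨by simp, fun l hl _ => h1 l hl, ?_, fun k hk => h4 k (by omega),
      fun k l hkl => h5 k l (by omega)⟩
    rw [h4 (i + 1) (by omega)]
    simp [boundaryLPP]

/-- The stationary last-passage time: exact mean and diffusive fluctuations. -/
lemma boundaryLPP_stationary (hmeas : ∀ p, Measurable (u p)) (hindep : iIndepFun u P)
    (hexp : ∀ p t, 0 ≤ t → P {ω | u p ω ≤ t} = ENNReal.ofReal (1 - Real.exp (-t)))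
    {α β : ℝ} (hα : 0 < α) (hβ : 0 < β) (hαβ : α + β = 1) (M N : ℕ) :
    Integrable (fun ω => boundaryLPP α⁻¹ β⁻¹ (fun p => u p ω) M N) P ∧
    ∫ ω, boundaryLPP α⁻¹ β⁻¹ (fun p => u p ω) M N ∂P = M / α + N / β ∧
    ∫ ω, |boundaryLPP α⁻¹ β⁻¹ (fun p => u p ω) M N - (M / α + N / β)| ∂P ≤
      Real.sqrt M / α + Real.sqrt N / β := by
  obtain ⟨X, hX, hst⟩ := exists_isStage hmeas hindep hexp hα hβ hαβ N M 0 (Nat.zero_le _)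
  obtain ⟨i1, m1, v1⟩ := (isExpFamily_axis hmeas hindep hexp hα hβ).sum_bounds hα (n := M)
    (fun k => (k + 1, 0)) (fun k l h => by simpa using h) (fun k => rfl)
  obtain ⟨i2, m2, v2⟩ := hX.sum_bounds hβ (n := N)
    (fun k => (0, k + 1)) (fun k l h => by simpa using h) (fun k => rfl)
  set S : Ω → ℝ := fun ω => ∑ k ∈ Finset.range M, (axisRate α β (k + 1, 0))⁻¹ * u (k + 1, 0) ω
  set T : Ω → ℝ := fun ω => ∑ k ∈ Finset.range N, X (0, k + 1) ω
  have hK : ∀ ω, boundaryLPP α⁻¹ β⁻¹ (fun p => u p ω) M N = S ω + T ω := fun ω => by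
    have h1 : ∀ m, boundaryLPP α⁻¹ β⁻¹ (fun p => u p ω) m 0 =
        ∑ k ∈ Finset.range m, (axisRate α β (k + 1, 0))⁻¹ * u (k + 1, 0) ω := fun m => by
      induction m with
      | zero => simp [boundaryLPP]
      | succ m ih => rw [Finset.sum_range_succ, ← ih]; simp [boundaryLPP, axisRate]
    have h2 : T ω = boundaryLPP α⁻¹ β⁻¹ (fun p => u p ω) M N -
        boundaryLPP α⁻¹ β⁻¹ (fun p => u p ω) M 0 := by
      rw [← Finset.sum_range_sub]
      exact Finset.sum_congr rfl fun l hl =>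
        (hst ω).todo l (Finset.mem_range.mp hl) (Nat.zero_le _)
    rw [h2, h1]; ring
  simp_rw [hK]
  refine ⟨i1.add i2, by rw [integral_add i1 i2, m1, m2], ?_⟩
  have j1 := (i1.sub (integrable_const (M / α))).abs
  have j2 := (i2.sub (integrable_const (N / β))).abs
  calc ∫ ω, |S ω + T ω - (M / α + N / β)| ∂P
      ≤ ∫ ω, (|S ω - M / α| + |T ω - N / β|) ∂P := by
        refine integral_mono ((i1.add i2).sub (integrable_const _)).abs (j1.add j2) fun ω => ?_
        have := abs_add_le (S ω - M / α) (T ω - N / β)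
        beta_reduce
        rwa [show S ω + T ω - (M / α + N / β) = S ω - M / α + (T ω - N / β) by ring]
    _ = ∫ ω, |S ω - M / α| ∂P + ∫ ω, |T ω - N / β| ∂P := integral_add j1 j2
    _ ≤ _ := add_le_add v1 v2

end Stationary

section Limit

open ProbabilityTheory Measure
open scoped Topology

lemma measurable_boundaryLPP {Ω : Type*} [MeasurableSpace Ω] {u : ℕ × ℕ → Ω → ℝ}
    (hmeas : ∀ p, Measurable (u p)) (a b : ℝ) (i j : ℕ) :
    Measurable fun ω => boundaryLPP a b (fun p => u p ω) i j := by
  induction i generalizing j with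
  | zero =>
    induction j with
    | zero => simp [boundaryLPP]
    | succ j ih => simp only [boundaryLPP]; exact ih.add ((hmeas _).const_mul _)
  | succ i ihi =>
    induction j with
    | zero => simp only [boundaryLPP]; exact (ihi 0).add ((hmeas _).const_mul _)
    | succ j ihj => simp only [boundaryLPP]; exact ((ihi _).max ihj).add (hmeas _)

lemma ae_forall_nonneg {Ω : Type*} [MeasurableSpace Ω] {P : Measure Ω} {u : ℕ × ℕ → Ω → ℝ}
    (hexp : ∀ p t, 0 ≤ t → P {ω | u p ω ≤ t} = ENNReal.ofReal (1 - Real.exp (-t))) :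
    ∀ᵐ ω ∂P, ∀ p, 0 ≤ u p ω := by
  refine ae_all_iff.mpr fun p => ?_
  have h : ∀ᵐ ω ∂P, ¬ u p ω ≤ 0 := by simp [ae_iff, hexp p 0 le_rfl]
  exact h.mono fun ω hω => (not_le.mp hω).le

variable {Ω : Type*} [MeasurableSpace Ω] {P : Measure Ω} [IsProbabilityMeasure P]
  {u : ℕ × ℕ → Ω → ℝ}

lemma integrable_boundaryLPP_zero (hmeas : ∀ p, Measurable (u p)) (hindep : iIndepFun u P)
    (hexp : ∀ p t, 0 ≤ t → P {ω | u p ω ≤ t} = ENNReal.ofReal (1 - Real.exp (-t))) (M N : ℕ) :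
    Integrable (fun ω => boundaryLPP 0 0 (fun p => u p ω) M N) P := by
  refine (boundaryLPP_stationary hmeas hindep hexp (α := 1 / 2) (β := 1 / 2) (by norm_num)
    (by norm_num) (by norm_num) M N).1.mono'
    (measurable_boundaryLPP hmeas _ _ _ _).aestronglyMeasurable ?_
  filter_upwards [ae_forall_nonneg hexp] with ω hω
  rw [Real.norm_of_nonneg (boundaryLPP_nonneg hω le_rfl le_rfl _ _)]
  exact boundaryLPP_mono hω (by norm_num) (by norm_num) _ _

lemma integral_boundaryLPP_zero_le (hmeas : ∀ p, Measurable (u p)) (hindep : iIndepFun u P)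
    (hexp : ∀ p t, 0 ≤ t → P {ω | u p ω ≤ t} = ENNReal.ofReal (1 - Real.exp (-t)))
    {α β : ℝ} (hα : 0 < α) (hβ : 0 < β) (hαβ : α + β = 1) (M N : ℕ) :
    ∫ ω, boundaryLPP 0 0 (fun p => u p ω) M N ∂P ≤ M / α + N / β := by
  obtain ⟨hi, hm, -⟩ := boundaryLPP_stationary hmeas hindep hexp hα hβ hαβ M N
  rw [← hm]
  refine integral_mono_ae (integrable_boundaryLPP_zero hmeas hindep hexp M N) hi ?_
  filter_upwards [ae_forall_nonneg hexp] with ω hω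
  exact boundaryLPP_mono hω (by positivity) (by positivity) _ _

lemma le_integral_boundaryLPP_zero (hmeas : ∀ p, Measurable (u p)) (hindep : iIndepFun u P)
    (hexp : ∀ p t, 0 ≤ t → P {ω | u p ω ≤ t} = ENNReal.ofReal (1 - Real.exp (-t)))
    {α β θ : ℝ} (hα : 0 < α) (hβ : 0 < β) (hαβ : α + β = 1) (h0 : 0 < θ) (h1 : θ < 1) (M N : ℕ) :
    (M / α + N / β) - θ / (1 - θ) *
      (max ((M / (θ * α) + N / (1 - θ * α)) - (M / α + N / β)) 0 +
        max ((M / (1 - θ * β) + N / (θ * β)) - (M / α + N / β)) 0 +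
        ((Real.sqrt M / (θ * α) + Real.sqrt N / (1 - θ * α)) +
          (Real.sqrt M / (1 - θ * β) + Real.sqrt N / (θ * β)) +
          2 * (Real.sqrt M / α + Real.sqrt N / β))) ≤
    ∫ ω, boundaryLPP 0 0 (fun p => u p ω) M N ∂P := by
  have hα₁ : 0 < 1 - θ * α := by nlinarith
  have hβ₂ : 0 < 1 - θ * β := by nlinarith
  obtain ⟨hi, hm, he⟩ := boundaryLPP_stationary hmeas hindep hexp hα hβ hαβ M N
  obtain ⟨hi₁, -, he₁⟩ := boundaryLPP_stationary hmeas hindep hexp (mul_pos h0 hα) hα₁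
    (by ring) M N
  obtain ⟨hi₂, -, he₂⟩ := boundaryLPP_stationary hmeas hindep hexp hβ₂ (mul_pos h0 hβ)
    (by ring) M N
  have hL := integrable_boundaryLPP_zero hmeas hindep hexp M N
  set m : ℝ := M / α + N / β
  set m₁ : ℝ := M / (θ * α) + N / (1 - θ * α)
  set m₂ : ℝ := M / (1 - θ * β) + N / (θ * β)
  set K : Ω → ℝ := fun ω => boundaryLPP α⁻¹ β⁻¹ (fun p => u p ω) M N with hK
  set K₁ : Ω → ℝ := fun ω => boundaryLPP (θ * α)⁻¹ (1 - θ * α)⁻¹ (fun p => u p ω) M N with hK₁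
  set K₂ : Ω → ℝ := fun ω => boundaryLPP (1 - θ * β)⁻¹ (θ * β)⁻¹ (fun p => u p ω) M N with hK₂
  set L : Ω → ℝ := fun ω => boundaryLPP 0 0 (fun p => u p ω) M N
  have j : Integrable (fun ω => 2 * |K ω - m|) P :=
    (hi.sub (integrable_const m)).abs.const_mul 2
  have j₁ : Integrable (fun ω => |K₁ ω - m₁|) P := (hi₁.sub (integrable_const m₁)).abs
  have j₂ : Integrable (fun ω => |K₂ ω - m₂|) P := (hi₂.sub (integrable_const m₂)).abs
  have j₁₂ : Integrable (fun ω => |K₁ ω - m₁| + |K₂ ω - m₂|) P := j₁.add j₂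
  have jall : Integrable (fun ω => (|K₁ ω - m₁| + |K₂ ω - m₂|) + 2 * |K ω - m|) P := j₁₂.add j
  have key : ∀ᵐ ω ∂P, (1 - θ) * (K ω - L ω) ≤ θ * ((max (m₁ - m) 0 + max (m₂ - m) 0) +
      ((|K₁ ω - m₁| + |K₂ ω - m₂|) + 2 * |K ω - m|)) := by
    filter_upwards [ae_forall_nonneg hexp] with ω hω
    have h := boundaryLPP_sub_le (a := α⁻¹) (b := β⁻¹) (a' := (1 - θ * β)⁻¹)
      (b' := (1 - θ * α)⁻¹) hω (by positivity) (by positivity) (by positivity) (by positivity)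
      h0 h1.le M N
    rw [show α⁻¹ / θ = (θ * α)⁻¹ by field_simp, show β⁻¹ / θ = (θ * β)⁻¹ by field_simp] at h
    refine h.trans (mul_le_mul_of_nonneg_left ?_ h0.le)
    have tri : ∀ x x' y y' : ℝ, max (x - y) 0 ≤ max (x' - y') 0 + |x - x'| + |y - y'| := by
      intro x x' y y'
      have := le_max_left (x' - y') 0
      have := le_max_right (x' - y') 0
      have := le_abs_self (x - x')
      have := neg_abs_le (y - y')
      exact max_le (by linarith) (by positivity)
    have t₁ := tri (K₁ ω) m₁ (K ω) m
    have t₂ := tri (K₂ ω) m₂ (K ω) m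
    simp only [hK, hK₁, hK₂] at t₁ t₂ ⊢
    linarith
  have hint := integral_mono_ae ((hi.sub hL).const_mul (1 - θ))
    (((integrable_const _).add jall).const_mul θ) key
  simp only [Pi.add_apply, Pi.sub_apply] at hint
  rw [integral_const_mul, integral_const_mul, integral_sub hi hL, hm,
    integral_add (integrable_const _) jall, integral_add j₁₂ j, integral_add j₁ j₂,
    integral_const_mul] at hint
  simp only [integral_const, probReal_univ, smul_eq_mul, one_mul] at hint
  have hθ : 0 < 1 - θ := sub_pos.mpr h1
  rw [sub_le_comm, div_mul_eq_mul_div, le_div_iff₀ hθ, mul_comm]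
  refine hint.trans (mul_le_mul_of_nonneg_left ?_ h0.le)
  linarith

lemma tendsto_floor_cost {γ : ℝ} (hγ : 0 ≤ γ) (a b : ℝ) :
    Tendsto (fun N : ℕ => ((⌊γ * N⌋₊ : ℝ) / a + N / b) / N) atTop (𝓝 (γ / a + 1 / b)) := by
  have h := ((tendsto_nat_floor_mul_div_atTop hγ).comp
    (tendsto_natCast_atTop_atTop (R := ℝ))).div_const a |>.add_const (1 / b)
  refine h.congr' ?_
  filter_upwards [eventually_gt_atTop 0] with N hN
  have : (N : ℝ) ≠ 0 := by positivity
  simp only [Function.comp]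
  field_simp

lemma tendsto_floor_sqrt_cost {γ : ℝ} (hγ : 0 ≤ γ) (a b : ℝ) :
    Tendsto (fun N : ℕ => (Real.sqrt (⌊γ * N⌋₊ : ℝ) / a + Real.sqrt N / b) / N) atTop (𝓝 0) := by
  have hN : Tendsto (fun N : ℕ => (Real.sqrt N)⁻¹) atTop (𝓝 0) :=
    tendsto_inv_atTop_zero.comp (Real.tendsto_sqrt_atTop.comp tendsto_natCast_atTop_atTop)
  have h := (((tendsto_nat_floor_mul_div_atTop hγ).comp
    (tendsto_natCast_atTop_atTop (R := ℝ))).sqrt.div_const a |>.add_const (1 / b)).mul hN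
  rw [mul_zero] at h
  refine h.congr' ?_
  filter_upwards [eventually_gt_atTop 0] with N hN
  have h0 : (0 : ℝ) < Real.sqrt N := by positivity
  have h1 : (N : ℝ) = Real.sqrt N * Real.sqrt N := (Real.mul_self_sqrt (by positivity)).symm
  simp only [Function.comp]
  rw [Real.sqrt_div (by positivity)]
  generalize Real.sqrt (⌊γ * N⌋₊ : ℝ) = x
  generalize Real.sqrt N = y at *
  rw [h1]
  field_simp

/-- The lower bound of `le_integral_boundaryLPP_zero`, rescaled, with `θ` close to `1`. -/
lemma exists_lower_rate {α β γ a : ℝ} (hα : 0 < α) (hβ : 0 < β) (hαβ : α + β = 1)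
    (hγ : γ * β ^ 2 = α ^ 2) (ha : a < γ / α + 1 / β) :
    ∃ θ, 0 < θ ∧ θ < 1 ∧ a < (γ / α + 1 / β) - θ / (1 - θ) *
      (max ((γ / (θ * α) + 1 / (1 - θ * α)) - (γ / α + 1 / β)) 0 +
        max ((γ / (1 - θ * β) + 1 / (θ * β)) - (γ / α + 1 / β)) 0) := by
  let R : ℝ → ℝ := fun θ => (γ / α + 1 / β) -
    (max (γ / α - α * θ / ((1 - θ * α) * β)) 0 + max (1 / β - γ * β * θ / ((1 - θ * β) * α)) 0)
  have hβ' : 1 - α = β := by linarith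
  have hα' : 1 - β = α := by linarith
  have hR1 : R 1 = γ / α + 1 / β := by
    have e1 : γ / α - α * 1 / ((1 - 1 * α) * β) = 0 := by
      rw [one_mul, hβ']; field_simp; linarith
    have e2 : 1 / β - γ * β * 1 / ((1 - 1 * β) * α) = 0 := by
      rw [one_mul, hα']; field_simp; linarith
    simp only [R, e1, e2]; simp
  have hRc : ContinuousAt R 1 := by
    have n1 : (1 - 1 * α) * β ≠ 0 := by rw [one_mul, hβ']; positivity
    have n2 : (1 - 1 * β) * α ≠ 0 := by rw [one_mul, hα']; positivity
    fun_prop (disch := assumption)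
  have hev : ∀ᶠ θ in 𝓝[<] (1 : ℝ), a < R θ :=
    (hRc.mono_left nhdsWithin_le_nhds).eventually (lt_mem_nhds (hR1 ▸ ha))
  obtain ⟨θ, hθ, h0, h1⟩ := (hev.and (Ioo_mem_nhdsLT (zero_lt_one' ℝ))).exists
  refine ⟨θ, h0, h1, hθ.trans_le (le_of_eq ?_)⟩
  have hθ' : 0 < 1 - θ := sub_pos.mpr h1
  have hα₁ : 0 < 1 - θ * α := by nlinarith
  have hβ₂ : 0 < 1 - θ * β := by nlinarith
  have hc : 0 ≤ θ / (1 - θ) := by positivity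
  simp only [R]
  rw [mul_add, mul_max_of_nonneg _ _ hc, mul_max_of_nonneg _ _ hc, mul_zero]
  congr 3
  · generalize hd : 1 - θ * α = d at *
    field_simp
    linear_combination (-α * θ) * hαβ - α * θ * hd
  · generalize hd : 1 - θ * β = d at *
    field_simp
    linear_combination (-β * γ * θ) * hαβ - β * γ * θ * hd

lemma tendsto_integral_boundaryLPP_zero (hmeas : ∀ p, Measurable (u p)) (hindep : iIndepFun u P)
    (hexp : ∀ p t, 0 ≤ t → P {ω | u p ω ≤ t} = ENNReal.ofReal (1 - Real.exp (-t)))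
    {α β γ : ℝ} (hα : 0 < α) (hβ : 0 < β) (hαβ : α + β = 1) (hγ : γ * β ^ 2 = α ^ 2) :
    Tendsto (fun N : ℕ => (∫ ω, boundaryLPP 0 0 (fun p => u p ω) ⌊γ * N⌋₊ N ∂P) / N) atTop
      (𝓝 (γ / α + 1 / β)) := by
  have hγ0 : 0 ≤ γ := by
    by_contra h
    nlinarith [mul_pos hα hα, mul_pos hβ hβ]
  have scale : ∀ m m₁ m₂ e e₁ e₂ c n : ℝ, 0 < n →
      m / n - c * (max (m₁ / n - m / n) 0 + max (m₂ / n - m / n) 0 +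
        (e₁ / n + e₂ / n + 2 * (e / n))) =
      (m - c * (max (m₁ - m) 0 + max (m₂ - m) 0 + (e₁ + e₂ + 2 * e))) / n := by
    intro m m₁ m₂ e e₁ e₂ c n hn
    rw [← sub_div, ← sub_div, ← zero_div n, max_div_div_right hn.le, max_div_div_right hn.le,
      zero_div]
    ring
  refine tendsto_order.2 ⟨fun a ha => ?_, fun a ha => ?_⟩
  · obtain ⟨θ, h0, h1, hθ⟩ := exists_lower_rate hα hβ hαβ hγ ha
    have hm := tendsto_floor_cost hγ0 α β
    have hm₁ := tendsto_floor_cost hγ0 (θ * α) (1 - θ * α)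
    have hm₂ := tendsto_floor_cost hγ0 (1 - θ * β) (θ * β)
    have he := tendsto_floor_sqrt_cost hγ0 α β
    have he₁ := tendsto_floor_sqrt_cost hγ0 (θ * α) (1 - θ * α)
    have he₂ := tendsto_floor_sqrt_cost hγ0 (1 - θ * β) (θ * β)
    have hlim := hm.sub (((((hm₁.sub hm).max (tendsto_const_nhds (x := (0 : ℝ)))).add
      ((hm₂.sub hm).max (tendsto_const_nhds (x := (0 : ℝ))))).add
        ((he₁.add he₂).add (he.const_mul 2))).const_mul (θ / (1 - θ)))
    simp only [add_zero, mul_zero] at hlim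
    filter_upwards [hlim.eventually (lt_mem_nhds hθ), eventually_gt_atTop 0] with N hN hN0
    have hN0' : (0 : ℝ) < N := by exact_mod_cast hN0
    refine hN.trans_le ?_
    have h := div_le_div_of_nonneg_right
      (le_integral_boundaryLPP_zero hmeas hindep hexp hα hβ hαβ h0 h1 ⌊γ * N⌋₊ N) hN0'.le
    exact (scale _ _ _ _ _ _ _ _ hN0').trans_le h
  · filter_upwards [(tendsto_floor_cost hγ0 α β).eventually (gt_mem_nhds ha)] with N hN
    refine lt_of_le_of_lt ?_ hN
    gcongr
    exact integral_boundaryLPP_zero_le hmeas hindep hexp hα hβ hαβ _ _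

end Limit

/-- For each `γ ≥ 1`, `lim_{N→∞} (1/N) 𝔼[H(⌊γN⌋,N)] = (1+√γ)²`. -/
theorem stmt6
    {Ω : Type*} [MeasurableSpace Ω] (ℙ : Measure Ω) [IsProbabilityMeasure ℙ]
    (u : ℕ × ℕ → Ω → ℝ)
    (hmeas : ∀ p, Measurable (u p))
    (hindep : ProbabilityTheory.iIndepFun u ℙ)
    (hexp : ∀ p t, 0 ≤ t → ℙ {ω | u p ω ≤ t} = ENNReal.ofReal (1 - Real.exp (-t)))
    (γ : ℝ) (hγ : 1 ≤ γ) :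
    Tendsto
      (fun N : ℕ => (1 / (N : ℝ)) * ∫ ω, lppSupR (fun p => u p ω) ⌊γ * N⌋₊ N ∂ℙ)
      atTop (nhds ((1 + Real.sqrt γ) ^ 2)) := by
  have hs : 1 ≤ Real.sqrt γ := Real.one_le_sqrt.mpr hγ
  have hsq : Real.sqrt γ ^ 2 = γ := Real.sq_sqrt (by linarith)
  set s := Real.sqrt γ
  have h1s : 0 < 1 + s := by linarith
  have h := tendsto_integral_boundaryLPP_zero hmeas hindep hexp (α := s / (1 + s))
    (β := 1 / (1 + s)) (γ := γ) (by positivity) (by positivity) (by field_simp; ring)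
    (by rw [← hsq]; field_simp)
  have hval : γ / (s / (1 + s)) + 1 / (1 / (1 + s)) = (1 + s) ^ 2 := by
    rw [← hsq]; field_simp; ring
  rw [hval] at h
  refine h.congr' ?_
  filter_upwards [eventually_ge_atTop 1] with N hN
  have hM : 1 ≤ ⌊γ * N⌋₊ := by
    have : (1 : ℝ) ≤ N := by exact_mod_cast hN
    exact Nat.le_floor (by push_cast; nlinarith)
  rw [div_eq_inv_mul, one_div]
  congr 1
  refine integral_congr_ae ?_
  filter_upwards [ae_forall_nonneg hexp] with ω hω
  exact (lppSupR_eq_boundaryLPP hω hM hN).symm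
end
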